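/- arXiv:1107.2102 — 4 statements merged into one kernel-verified Lean document; each statement's English description precedes it below -/
import Mathlib

section
/- Let (R,𝔪) be a Noetherian local ring, M a finitely generated R-module, and 𝔭 ∈ Supp M such that M_𝔭 is not Cohen–Macaulay over R_𝔭. Then 𝔞(M) := ⋂_{i < dim M} Ann_R H^i_𝔪(M) is contained in 𝔭. -/
noncomputable section
open CategoryTheory

namespace Paper

variable (R : Type) [CommRing R]

/-- The `i`-th local cohomology of the `R`-module `M` with respect to the ideal `I`. -/
abbrev H (I : Ideal R) (i : ℕ) (M : Type) [AddCommGroup M] [Module R M] : ModuleCat R :=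
  (localCohomology I i).obj (ModuleCat.of R M)

/-- `N` is a `p`-secondary submodule of `M`: it is nonzero, every `r : R` acts on it either
surjectively or nilpotently, and `p` is the radical of its annihilator. -/
def IsSecondaryFor {M : Type} [AddCommGroup M] [Module R M]
    (N : Submodule R M) (p : Ideal R) : Prop :=
  N ≠ ⊥ ∧
  (∀ r : R, (∀ m ∈ N, ∃ n ∈ N, r • n = m) ∨ (∃ k : ℕ, ∀ m ∈ N, r ^ k • m = 0)) ∧
  N.annihilator.radical = p

/-- A minimal secondary representation of the module `M`. -/
structure MinSecRep (M : Type) [AddCommGroup M] [Module R M] where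
  n : ℕ
  S : Fin n → Submodule R M
  p : Fin n → Ideal R
  prime : ∀ i, (p i).IsPrime
  sec : ∀ i, IsSecondaryFor R (S i) (p i)
  sum : (⨆ i, S i) = ⊤
  inj : Function.Injective p
  irred : ∀ j, ¬ (S j ≤ ⨆ i ∈ ({j}ᶜ : Set (Fin n)), S i)

/-- `M` is representable: it is a (finite) sum of secondary submodules. -/
def IsRepresentable (M : Type) [AddCommGroup M] [Module R M] : Prop :=
  ∃ (n : ℕ) (S : Fin n → Submodule R M) (p : Fin n → Ideal R),
    (∀ i, (p i).IsPrime) ∧ (∀ i, IsSecondaryFor R (S i) (p i)) ∧ (⨆ i, S i) = ⊤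

/-- The set of attached primes of `M`: the primes occurring in a minimal secondary
representation of `M`. -/
def attached (M : Type) [AddCommGroup M] [Module R M] : Set (Ideal R) :=
  {q | ∃ (rep : MinSecRep R M) (i : Fin rep.n), rep.p i = q}

/-- The coheight (dimension of `R/I`): Krull dimension of the set of primes containing `I`. -/
def coheight (I : Ideal R) : WithBot ℕ∞ :=
  Order.krullDim {p : Ideal R // p.IsPrime ∧ I ≤ p}

/-- The Krull dimension of the ring `R`. -/
def ringDim : WithBot ℕ∞ := Order.krullDim {p : Ideal R // p.IsPrime}

/-- The Krull dimension of (the support of) the finitely generated module `M`. -/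
def dimMod (M : Type) [AddCommGroup M] [Module R M] : WithBot ℕ∞ :=
  coheight R (Module.annihilator R M)

/-- The dimension of the localized module `M_q`: chains of primes in the support of `M`
contained in `q`. -/
def dimModAt (M : Type) [AddCommGroup M] [Module R M] (q : Ideal R) : WithBot ℕ∞ :=
  Order.krullDim {p : Ideal R // p.IsPrime ∧ Module.annihilator R M ≤ p ∧ p ≤ q}

/-- The support of a finitely generated module: primes containing the annihilator. -/
def supp (M : Type) [AddCommGroup M] [Module R M] : Set (Ideal R) :=
  {p | p.IsPrime ∧ Module.annihilator R M ≤ p}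

/-- `Min M`: minimal primes of the support of `M`. -/
def minSupp (M : Type) [AddCommGroup M] [Module R M] : Set (Ideal R) :=
  (Module.annihilator R M).minimalPrimes

/-- `Assh M`: primes in the support of maximal coheight. -/
def assh (M : Type) [AddCommGroup M] [Module R M] : Set (Ideal R) :=
  {p | p ∈ supp R M ∧ coheight R p = dimMod R M}

open RingTheory.Sequence in
/-- Depth of `M` with respect to the ideal `J`: supremum of the lengths of `M`-regular
sequences contained in `J`. -/
def depthOn (J : Ideal R) (M : Type) [AddCommGroup M] [Module R M] : ℕ∞ :=
  ⨆ l ∈ {l : List R | (∀ x ∈ l, x ∈ J) ∧ IsRegular M l}, (l.length : ℕ∞)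

/-- `M` is a Cohen–Macaulay module over the local ring `R`: depth = dimension. -/
def IsCMLocalMod [IsLocalRing R] (M : Type) [AddCommGroup M] [Module R M] : Prop :=
  (depthOn R (IsLocalRing.maximalIdeal R) M : WithBot ℕ∞) = dimMod R M

/-- `R` is a Cohen–Macaulay local ring: it is local and its depth (w.r.t. its Jacobson
radical, which is the maximal ideal) equals its Krull dimension. -/
def IsCMLocalRing : Prop :=
  IsLocalRing R ∧ ((depthOn R ((⊥ : Ideal R).jacobson) R : WithBot ℕ∞) = ringDim R)

/-- `R` is a Cohen–Macaulay ring: all of its localizations at primes are CM local rings. -/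
def IsCMRing : Prop :=
  ∀ (p : Ideal R) [p.IsPrime], IsCMLocalRing (Localization.AtPrime p)

/-- `M` is an equidimensional module: every minimal prime of its support has coheight equal
to the dimension of `M`. -/
def IsEquidim (M : Type) [AddCommGroup M] [Module R M] : Prop :=
  ∀ q ∈ minSupp R M, coheight R q = dimMod R M

/-- `R` is catenary: any two saturated chains of primes with the same endpoints have the
same length. -/
def IsCatenary : Prop :=
  ∀ (c₁ c₂ : LTSeries {p : Ideal R // p.IsPrime}),
    c₁.head = c₂.head → c₁.last = c₂.last →
    (∀ i : Fin c₁.length, c₁.toFun i.castSucc ⋖ c₁.toFun i.succ) →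
    (∀ i : Fin c₂.length, c₂.toFun i.castSucc ⋖ c₂.toFun i.succ) →
    c₁.length = c₂.length

/-- `R` is universally catenary: every finitely generated `R`-algebra is catenary. -/
def IsUnivCatenary : Prop :=
  ∀ (A : Type) [CommRing A] [Algebra R A], Algebra.FiniteType R A → IsCatenary A

/-- `x` is a uniform local cohomological annihilator of `M`: `x` avoids all minimal primes
of `M` and, for every maximal ideal `m`, kills `H^i_m(M)` for all `i < dim M_m`. -/
def IsULCA (M : Type) [AddCommGroup M] [Module R M] (x : R) : Prop :=
  (∀ p ∈ minSupp R M, x ∉ p) ∧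
  ∀ (m : Ideal R), m.IsMaximal → ∀ i : ℕ, (i : WithBot ℕ∞) < dimModAt R M m →
    ∀ y : H R m i M, x • y = 0

/-- `M` has a uniform local cohomological annihilator. -/
def HasULCA (M : Type) [AddCommGroup M] [Module R M] : Prop := ∃ x, IsULCA R M x

/-- `R/p` has a uniform local cohomological annihilator (local case): some `x ∉ p` kills
`H^i_𝔪(R/p)` for all `i < dim R/p`. -/
def HasULCAQuot [IsLocalRing R] (p : Ideal R) : Prop :=
  ∃ x ∉ p, ∀ i : ℕ, (i : WithBot ℕ∞) < coheight R p →
    ∀ y : H R (IsLocalRing.maximalIdeal R) i (R ⧸ p), x • y = 0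

/-- `M` is generalized Cohen–Macaulay over the local ring `R`: a power of the maximal ideal
kills all local cohomology below the dimension. -/
def IsGCM [IsLocalRing R] (M : Type) [AddCommGroup M] [Module R M] : Prop :=
  ∃ n : ℕ, ∀ i : ℕ, (i : WithBot ℕ∞) < dimMod R M →
    ∀ a ∈ (IsLocalRing.maximalIdeal R) ^ n,
      ∀ y : H R (IsLocalRing.maximalIdeal R) i M, a • y = 0

end Paper

universe u

section Comparison

open Limits HomologicalComplex Opposite

variable {R : Type u} [CommRing R] {X X' : ModuleCat.{u} R}

/-- The image of a projective resolution under `Hom(-, Y)`, in the opposite category. -/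
abbrev CategoryTheory.ProjectiveResolution.homComplex (P : ProjectiveResolution X)
    (Y : ModuleCat.{u} R) : ChainComplex (ModuleCat.{u} R)ᵒᵖ ℕ :=
  (((linearYoneda R (ModuleCat.{u} R)).obj Y).rightOp.mapHomologicalComplex _).obj P.complex

/-- The inclusion of the `n`-cocycles of `Hom(P, Y)` into `Hom(P_n, Y)`. -/
abbrev CategoryTheory.ProjectiveResolution.cocycleToHom (P : ProjectiveResolution X)
    (Y : ModuleCat.{u} R) (n : ℕ) :
    ((P.homComplex Y).opcycles n).unop ⟶ ModuleCat.of R (P.complex.X n ⟶ Y) :=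
  ((P.homComplex Y).pOpcycles n).unop

/-- The left derived functors of the opposite of `Hom(-, Y)`, computed by the resolution `P`. -/
abbrev CategoryTheory.ProjectiveResolution.isoHomology (P : ProjectiveResolution X)
    (Y : ModuleCat.{u} R) (n : ℕ) :
    (((linearYoneda R (ModuleCat.{u} R)).obj Y).rightOp.leftDerived n).obj X ≅
      (P.homComplex Y).homology n :=
  P.isoLeftDerivedObj ((linearYoneda R (ModuleCat.{u} R)).obj Y).rightOp n

/-- The class in `Ext^n(X, Y)` of an `n`-cocycle of `Hom(P, Y)`. -/
abbrev CategoryTheory.ProjectiveResolution.cocycleToExt (P : ProjectiveResolution X)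
    (Y : ModuleCat.{u} R) (n : ℕ) :
    ((P.homComplex Y).opcycles n).unop ⟶
      ((Ext R (ModuleCat.{u} R) n).obj (op X)).obj Y :=
  ((P.isoHomology Y n).hom ≫ (P.homComplex Y).homologyι n).unop

lemma CategoryTheory.ProjectiveResolution.exists_cocycleToHom_eq
    (P : ProjectiveResolution X) {Y : ModuleCat.{u} R} {n : ℕ}
    (f : P.complex.X n ⟶ Y) (hf : P.complex.d (n + 1) n ≫ f = 0) :
    ∃ z, (P.cocycleToHom Y n).hom z = f := by
  have h : (ShortComplex.mk _ _ ((P.homComplex Y).d_pOpcycles (n + 1) n)).Exact :=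
    ShortComplex.exact_of_g_is_cokernel _ ((P.homComplex Y).opcyclesIsCokernel (n + 1) n (by simp))
  have h2 := h.unop
  rw [ShortComplex.moduleCat_exact_iff] at h2
  exact h2 f hf

lemma CategoryTheory.ProjectiveResolution.eq_zero_of_cocycleToExt_eq_zero
    (P : ProjectiveResolution X) {Y : ModuleCat.{u} R} (z)
    (hz : (P.cocycleToExt Y 0).hom z = 0) : z = 0 := by
  have : IsIso ((P.homComplex Y).homologyι 0) := by
    apply ShortComplex.isIso_homologyι
    exact (P.homComplex Y).shape _ _ (by simp)
  have h : Mono (P.cocycleToExt Y 0) :=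
    unop_mono_of_epi ((P.isoHomology Y 0).hom ≫ (P.homComplex Y).homologyι 0)
  exact ((ModuleCat.mono_iff_injective _).mp h)
    (hz.trans (map_zero _).symm)

lemma CategoryTheory.ProjectiveResolution.exists_d_comp_eq_cocycleToHom
    (P : ProjectiveResolution X) {Y : ModuleCat.{u} R} {n : ℕ} (z)
    (hz : (P.cocycleToExt Y (n + 1)).hom z = 0) :
    ∃ g : P.complex.X n ⟶ Y, P.complex.d (n + 1) n ≫ g = (P.cocycleToHom Y (n + 1)).hom z := by
  have h : (ShortComplex.mk _ _ ((P.homComplex Y).homologyι_comp_fromOpcycles (n + 1) n)).Exact :=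
    ShortComplex.exact_of_f_is_kernel _ ((P.homComplex Y).homologyIsKernel (n + 1) n (by simp))
  have h2 := h.unop
  rw [ShortComplex.moduleCat_exact_iff] at h2
  have hz' : ((P.homComplex Y).homologyι (n + 1)).unop.hom z = 0 := by
    have hinj := (ModuleCat.mono_iff_injective _).mp
      (unop_mono_of_epi (P.isoHomology Y (n + 1)).hom)
    exact hinj (hz.trans (map_zero _).symm)
  obtain ⟨g, hg⟩ := h2 z hz'
  refine ⟨g, ?_⟩
  have e := congrArg Quiver.Hom.unop ((P.homComplex Y).p_fromOpcycles (n + 1) n)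
  have e' := congrArg (fun f => f.hom g) e
  rw [← hg]
  exact e'.symm

lemma CategoryTheory.ProjectiveResolution.exists_cocycleToExt_eq_map {n : ℕ}
    {P : ProjectiveResolution X} {P' : ProjectiveResolution X'} {g : X' ⟶ X}
    (φ : ProjectiveResolution.Hom P' P g) (Y : ModuleCat.{u} R) (z) :
      ∃ z', (P'.cocycleToExt Y n).hom z' =
        (((Ext R (ModuleCat.{u} R) n).map g.op).app Y).hom ((P.cocycleToExt Y n).hom z) ∧
        (P'.cocycleToHom Y n).hom z' = φ.hom.f n ≫ (P.cocycleToHom Y n).hom z := by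
  let F := ((linearYoneda R (ModuleCat.{u} R)).obj Y).rightOp
  let ψ : P'.homComplex Y ⟶ P.homComplex Y := (F.mapHomologicalComplex _).map φ.hom
  refine ⟨(opcyclesMap ψ n).unop.hom z, ?_, ?_⟩
  · have e1 : (F.leftDerived n).map g ≫ (P.isoHomology Y n).hom =
        (P'.isoHomology Y n).hom ≫ homologyMap ψ n :=
      ProjectiveResolution.isoLeftDerivedObj_hom_naturality g P' P φ.hom
        φ.hom_f_zero_comp_π_f_zero F n
    have e2 : (F.leftDerived n).map g ≫ ((P.isoHomology Y n).hom ≫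
        (P.homComplex Y).homologyι n) = ((P'.isoHomology Y n).hom ≫
        (P'.homComplex Y).homologyι n) ≫ opcyclesMap ψ n := by
      rw [reassoc_of% e1, Category.assoc, ← homologyι_naturality]
    exact congrArg (fun f => f.hom z) (congrArg Quiver.Hom.unop e2).symm
  · have e2 := p_opcyclesMap ψ n
    exact congrArg (fun f => f.hom z) (congrArg Quiver.Hom.unop e2)

/-- If `r` kills the local cohomology `H^n_I(Y)`, every class in `Ext^n(R/I^s, Y)` multiplied by
`r` dies in `Ext^n(R/I^t, Y)` for large `t`. -/
lemma exists_ext_comp_eq_zero (I : Ideal R) (n : ℕ) (Y : ModuleCat.{u} R) (r : R)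
    (hr : ∀ x : (localCohomology I n).obj Y, r • x = 0) (s : ℕ)
    (e : Abelian.Ext (ModuleCat.of R (R ⧸ I ^ s)) Y n) :
    ∃ (t : ℕ) (h : s ≤ t), (Abelian.Ext.mk₀ (ModuleCat.ofHom
      (Submodule.factor (Ideal.pow_le_pow_right h)))).comp (r • e) (zero_add n) = 0 := by
  let P := ProjectiveResolution.of (ModuleCat.of R (R ⧸ I ^ s))
  obtain ⟨f, hf, rfl⟩ := P.extMk_surjective e (n + 1) rfl
  obtain ⟨z, hz⟩ := P.exists_cocycleToHom_eq f hf
  let D := localCohomology.diagram (localCohomology.idealPowersDiagram I) n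
  let x : ((D ⋙ (evaluation _ _).obj Y).obj (op (op s))) := (P.cocycleToExt Y n).hom (r • z)
  let hc := isColimitOfPreserves ((evaluation _ _).obj Y) (colimit.isColimit D)
  have hx : (((evaluation _ _).obj Y).mapCocone (colimit.cocone D)).ι.app (op (op s)) x = 0 := by
    have : x = r • (P.cocycleToExt Y n).hom z := map_smul _ _ _
    rw [this]
    exact (map_smul _ _ _).trans (hr _)
  rw [← map_zero (ModuleCat.Hom.hom ((((evaluation _ _).obj Y).mapCocone (colimit.cocone D)).ι.app
    (op (op s))))] at hx
  have : PreservesFilteredColimitsOfSize.{0, 0} (forget (ModuleCat.{u} R)) :=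
    preservesSmallestFilteredColimits_of_preservesFilteredColimits _
  obtain ⟨t, φ, hφ⟩ := (IsColimit.eq_iff' hc x 0).mp hx
  rw [map_zero] at hφ
  refine ⟨t.unop.unop, leOfHom φ.unop.unop, ?_⟩
  let g : ModuleCat.of R (R ⧸ I ^ t.unop.unop) ⟶ ModuleCat.of R (R ⧸ I ^ s) :=
    (localCohomology.ringModIdeals (localCohomology.idealPowersDiagram I)).map φ.unop
  let P' := ProjectiveResolution.of (ModuleCat.of R (R ⧸ I ^ t.unop.unop))
  let ψ : ProjectiveResolution.Hom P' P g :=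
    ⟨ProjectiveResolution.lift g P' P, HomologicalComplex.congr_hom
      (ProjectiveResolution.lift_commutes g P' P) 0⟩
  obtain ⟨z', hz', hz''⟩ := ProjectiveResolution.exists_cocycleToExt_eq_map ψ Y (r • z)
  have hz0 : (P'.cocycleToExt Y n).hom z' = 0 := hz'.trans hφ
  change (Abelian.Ext.mk₀ g).comp _ _ = 0
  rw [Abelian.Ext.smul_eq_comp_mk₀, ProjectiveResolution.extMk_comp_mk₀,
    ProjectiveResolution.mk₀_comp_extMk _ _ _ _ ψ]
  have hf' : ψ.hom.f n ≫ f ≫ (r • 𝟙 Y) = (P'.cocycleToHom Y n).hom z' := by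
    rw [hz'', map_smul, hz]
    simp
  cases n with
  | zero =>
    obtain rfl := P'.eq_zero_of_cocycleToExt_eq_zero _ hz0
    simp only [hf']
    simp
  | succ n =>
    rw [ProjectiveResolution.extMk_eq_zero_iff _ _ _ _ _ n rfl]
    obtain ⟨g, hg⟩ := P'.exists_d_comp_eq_cocycleToHom _ hz0
    exact ⟨g, hg.trans hf'.symm⟩

end Comparison

section ExtAnnihilation

open Abelian

variable {R : Type u} [CommRing R]

lemma ext_smul_eq_zero_of_shortExact {S : ShortComplex (ModuleCat.{u} R)} (hS : S.ShortExact)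
    {Y : ModuleCat.{u} R} {i : ℕ} {c₁ c₃ : R} (h₁ : ∀ e : Abelian.Ext S.X₁ Y i, c₁ • e = 0)
    (h₃ : ∀ e : Abelian.Ext S.X₃ Y i, c₃ • e = 0) (e : Abelian.Ext S.X₂ Y i) :
    (c₃ * c₁) • e = 0 := by
  obtain ⟨e', he'⟩ := Ext.contravariant_sequence_exact₂ hS Y (c₁ • e)
    (by rw [Ext.comp_smul, h₁])
  rw [mul_smul, ← he', ← Ext.comp_smul, h₃, Ext.comp_zero]

lemma ext_smul_eq_zero_of_comp_eq_zero {S : ShortComplex (ModuleCat.{u} R)} (hS : S.ShortExact)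
    {Y : ModuleCat.{u} R} {i : ℕ} {c : R}
    (h : ∀ j, j + 1 = i → ∀ e : Abelian.Ext S.X₁ Y j, c • e = 0)
    {e : Abelian.Ext S.X₃ Y i} (he : (Ext.mk₀ S.g).comp e (zero_add i) = 0) : c • e = 0 := by
  cases i with
  | zero =>
    have := hS.epi_g
    have he' : e = 0 := Ext.precomp_mk₀_injective_of_epi Y S.g
      (he.trans (Ext.comp_zero _ _ _ _ (zero_add 0)).symm)
    rw [he', smul_zero]
  | succ i =>
    obtain ⟨e', rfl⟩ := Ext.contravariant_sequence_exact₃ hS Y e he (add_comm 1 i)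
    rw [← Ext.comp_smul, h i rfl, Ext.comp_zero]

lemma ext_smul_eq_zero_pi {N Y : ModuleCat.{u} R} {i r : ℕ} {c : R}
    (h : ∀ e : Abelian.Ext N Y i, c • e = 0)
    (e : Abelian.Ext (ModuleCat.of R (Fin r → N)) Y i) : c • e = 0 := by
  let π (j : Fin r) : ModuleCat.of R (Fin r → N) ⟶ N := ModuleCat.ofHom (LinearMap.proj j)
  let ι (j : Fin r) : N ⟶ ModuleCat.of R (Fin r → N) :=
    ModuleCat.ofHom (LinearMap.single R (fun _ => N) j)
  have hid : 𝟙 (ModuleCat.of R (Fin r → N)) = ∑ j, π j ≫ ι j := by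
    ext x
    simp [π, ι, ModuleCat.hom_sum]
  rw [← Ext.mk₀_id_comp e, hid, Ext.mk₀_sum, Ext.sum_comp, Finset.smul_sum]
  refine Finset.sum_eq_zero fun j _ => ?_
  rw [← Ext.mk₀_comp_mk₀, Ext.comp_assoc_of_second_deg_zero, ← Ext.comp_smul, h, Ext.comp_zero]

lemma pow_smul_eq_zero_of_le {A : Type*} [AddCommGroup A] [Module R A] {a : R} {k l : ℕ}
    (h : k ≤ l) {x : A} (hx : a ^ k • x = 0) : a ^ l • x = 0 := by
  rw [← Nat.sub_add_cancel h, pow_add, mul_smul, hx, smul_zero]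

lemma pow_smul_ext_eq_zero_of_pow_le_annihilator [IsNoetherianRing R] {I : Ideal R}
    {Y : ModuleCat.{u} R} {a : R} {i : ℕ} (ha : ∀ x : (localCohomology I i).obj Y, a • x = 0)
    {k : ℕ} (hk : ∀ j, j + 1 = i → ∀ (N : ModuleCat.{u} R) [Module.Finite R N] (s : ℕ),
      I ^ s ≤ Module.annihilator R N → ∀ e : Abelian.Ext N Y j, a ^ k • e = 0)
    (N : ModuleCat.{u} R) [Module.Finite R N] (s : ℕ) (hs : I ^ s ≤ Module.annihilator R N)
    (e : Abelian.Ext N Y i) : a ^ (k + (k + 1)) • e = 0 := by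
  have hcyc : ∀ e : Abelian.Ext (ModuleCat.of R (R ⧸ I ^ s)) Y i, a ^ (k + 1) • e = 0 := by
    intro e
    obtain ⟨t, hst, ht⟩ := exists_ext_comp_eq_zero I i Y a ha s e
    rw [pow_succ, mul_smul]
    refine ext_smul_eq_zero_of_comp_eq_zero (LinearMap.shortExact_shortComplexKer
      (Submodule.factor_surjective (Ideal.pow_le_pow_right hst))) (fun j hj e => ?_) ht
    refine hk j hj _ t (fun x hx => ?_) e
    rw [Module.mem_annihilator]
    rintro ⟨y, hy⟩
    obtain ⟨y, rfl⟩ := Submodule.mkQ_surjective _ y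
    ext
    refine (Submodule.Quotient.mk_eq_zero _).mpr ?_
    exact Ideal.mul_mem_right _ _ hx
  obtain ⟨r, v, hv⟩ := Module.Finite.exists_fin (R := R) (M := N)
  let f : (Fin r → R ⧸ I ^ s) →ₗ[R] N := LinearMap.lsum R (fun _ => R ⧸ I ^ s) R fun j =>
    Submodule.liftQ (I ^ s) (LinearMap.toSpanSingleton R N (v j)) fun x hx => by
      rw [LinearMap.mem_ker, LinearMap.toSpanSingleton_apply]
      exact Module.mem_annihilator.mp (hs hx) (v j)
  have hf : Function.Surjective f := by
    rw [← LinearMap.range_eq_top, ← top_le_iff, ← hv, Submodule.span_le]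
    rintro _ ⟨j, rfl⟩
    refine ⟨Pi.single j (Submodule.Quotient.mk 1), ?_⟩
    rw [LinearMap.lsum_piSingle]
    exact (Submodule.liftQ_apply _ _ _).trans (one_smul R (v j))
  rw [pow_add, mul_smul]
  refine ext_smul_eq_zero_of_comp_eq_zero (LinearMap.shortExact_shortComplexKer hf)
    (fun j hj e => ?_) (e := a ^ (k + 1) • e) ?_
  · refine hk j hj _ s (fun x hx => ?_) e
    rw [Module.mem_annihilator]
    rintro ⟨y, hy⟩
    ext j
    obtain ⟨z, hz⟩ := Submodule.mkQ_surjective _ (y j)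
    change x • y j = 0
    rw [← hz, ← map_smul]
    exact (Submodule.Quotient.mk_eq_zero _).mpr (Ideal.mul_mem_right _ _ hx)
  · rw [Ext.comp_smul]
    exact ext_smul_eq_zero_pi hcyc _

/-- If `a` kills the local cohomology of `Y` with support in `I` in degrees at most `i`, then a
fixed power of `a` kills `Ext^i(N, Y)` for all finitely generated `I`-power torsion modules `N`. -/
lemma exists_pow_smul_ext_eq_zero_of_pow_le_annihilator [IsNoetherianRing R] (I : Ideal R)
    (Y : ModuleCat.{u} R) (a : R) (i : ℕ)
    (ha : ∀ j ≤ i, ∀ x : (localCohomology I j).obj Y, a • x = 0) :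
    ∃ k : ℕ, ∀ (N : ModuleCat.{u} R) [Module.Finite R N] (s : ℕ),
      I ^ s ≤ Module.annihilator R N → ∀ e : Abelian.Ext N Y i, a ^ k • e = 0 := by
  induction i with
  | zero => exact ⟨_, fun N _ => pow_smul_ext_eq_zero_of_pow_le_annihilator (k := 0) (ha 0 le_rfl)
      (fun j hj => by omega) N⟩
  | succ i ih =>
    obtain ⟨k, hk⟩ := ih (fun j hj => ha j (by omega))
    refine ⟨_, fun N _ => pow_smul_ext_eq_zero_of_pow_le_annihilator (ha _ le_rfl)
      (k := k) (fun j hj => ?_) N⟩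
    obtain rfl : j = i := by omega
    exact hk

end ExtAnnihilation

lemma supportDim_lt_of_pow_smul_eq_zero {R : Type*} [CommRing R] {N L : Type*}
    [AddCommGroup N] [Module R N]
    [Module.Finite R N] [AddCommGroup L] [Module R L] {b : R}
    (hb : ∀ q ∈ (Module.annihilator R N).minimalPrimes, b ∉ q)
    (hL : Module.support R L ⊆ Module.support R N) {m : ℕ} (hm : ∀ x : L, b ^ m • x = 0) {t : ℕ}
    (ht : Module.supportDim R N < (t + 1 : ℕ)) : Module.supportDim R L < t := by
  have hsub : Module.support R L ⊆ Module.support R (QuotSMulTop b N) := by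
    rw [Module.support_quotSMulTop]
    refine Set.subset_inter hL fun q hq => ?_
    have : b ^ m ∈ q.asIdeal :=
      Module.annihilator_le_of_mem_support hq (Module.mem_annihilator.mpr hm)
    simpa using q.2.mem_of_pow_mem m this
  have h1 : Module.supportDim R L ≤ Module.supportDim R (QuotSMulTop b N) :=
    Order.krullDim_le_of_strictMono (fun q => ⟨q.1, hsub q.2⟩) fun _ _ h => h
  have h2 := Module.supportDim_quotSMulTop_succ_le_of_notMem_minimalPrimes hb
  generalize Module.supportDim R (QuotSMulTop b N) = A at *
  refine h1.trans_lt ?_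
  have h3 := h2.trans_lt ht
  cases A with
  | bot => exact WithBot.bot_lt_coe _
  | coe A =>
    cases A with
    | top => exact absurd h3 (not_lt_of_ge le_top)
    | coe A => exact_mod_cast Nat.lt_of_succ_lt_succ (by exact_mod_cast h3)

section LocalAnnihilation

open Abelian IsLocalRing

variable {R : Type u} [CommRing R] [IsNoetherianRing R]

lemma exists_pow_maximalIdeal_le_annihilator_or [IsLocalRing R] (N : Type*) [AddCommGroup N]
    [Module R N] :
    (∃ s : ℕ, maximalIdeal R ^ s ≤ Module.annihilator R N) ∨
      ∃ b ∈ maximalIdeal R, ∀ q ∈ (Module.annihilator R N).minimalPrimes, b ∉ q := by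
  by_cases h : ∃ q ∈ (Module.annihilator R N).minimalPrimes, maximalIdeal R ≤ q
  · left
    obtain ⟨q, hq, hmq⟩ := h
    refine Ideal.exists_pow_le_of_le_radical_of_fg ?_ (IsNoetherian.noetherian _)
    rw [← Ideal.sInf_minimalPrimes]
    refine le_sInf fun p hp => ?_
    have hpq : p ≤ q := (le_maximalIdeal hp.1.1.ne_top).trans hmq
    exact hmq.trans (hq.2 hp.1 hpq)
  · right
    have := (Ideal.subset_union_prime_finite (f := id)
      ((Module.annihilator R N).finite_minimalPrimes_of_isNoetherianRing) ⊥ ⊥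
      (fun q hq _ _ => hq.1.1) (I := maximalIdeal R)).not.mpr h
    obtain ⟨b, hb, hb'⟩ := Set.not_subset.mp this
    exact ⟨b, hb, fun q hq hbq => hb' (Set.mem_biUnion hq hbq)⟩

lemma eq_zero_of_forall_mem_pow_smul [IsLocalRing R] {E : Type*} [AddCommGroup E] [Module R E]
    [Module.Finite R E] {b : R} (hb : b ∈ maximalIdeal R) {x : E}
    (hx : ∀ m : ℕ, ∃ y, x = b ^ m • y) : x = 0 := by
  have := Ideal.iInf_pow_smul_eq_bot_of_isLocalRing (M := E) (maximalIdeal R)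
    (Ideal.IsPrime.ne_top')
  rw [← Submodule.mem_bot R, ← this, Submodule.mem_iInf]
  intro m
  obtain ⟨y, rfl⟩ := hx m
  exact Submodule.smul_mem_smul (Ideal.pow_mem_pow hb m) trivial

lemma ext_smul_eq_zero_of_isSMulRegular [IsLocalRing R] {N Y : ModuleCat.{u} R}
    [Module.Finite R N] [Module.Finite R Y] {b c : R} (hb : b ∈ maximalIdeal R)
    (hreg : IsSMulRegular N b) {i : ℕ}
    (h : ∀ (m : ℕ) (e : Abelian.Ext (ModuleCat.of R (QuotSMulTop (b ^ m) N)) Y (i + 1)), c • e = 0)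
    (e : Abelian.Ext N Y i) : c • e = 0 := by
  refine eq_zero_of_forall_mem_pow_smul hb fun m => ?_
  have hS := (hreg.pow m).smulShortComplex_shortExact
  obtain ⟨e', he'⟩ := Ext.contravariant_sequence_exact₁ hS Y (c • e) (add_comm 1 i)
    ((Ext.comp_smul hS.extClass e (add_comm 1 i) c).trans (h m _))
  refine ⟨e', ?_⟩
  have hmul (x : Abelian.Ext N Y i) :
      (Ext.mk₀ (b ^ m • 𝟙 N)).comp x (zero_add i) = b ^ m • x := by
    rw [Ext.mk₀_smul, Ext.smul_comp, Ext.mk₀_id_comp]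
  exact he'.symm.trans (hmul e')

lemma exists_isSMulRegular_range_lsmul (N : Type*) [AddCommGroup N] [Module R N]
    [Module.Finite R N] (b : R) :
    ∃ n : ℕ, IsSMulRegular (LinearMap.range (LinearMap.lsmul R N (b ^ n))) b := by
  obtain ⟨n, hn⟩ := monotone_stabilizes_iff_noetherian.mpr (inferInstance : IsNoetherian R N)
    ⟨fun n => LinearMap.ker (LinearMap.lsmul R N (b ^ n)), fun k l hkl x hx => by
      obtain ⟨d, rfl⟩ := exists_add_of_le hkl
      simp only [LinearMap.mem_ker, LinearMap.lsmul_apply] at hx ⊢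
      rw [add_comm, pow_add, mul_smul, hx, smul_zero]⟩
  refine ⟨n, isSMulRegular_iff_right_eq_zero_of_smul.mpr ?_⟩
  rintro ⟨_, y, rfl⟩ hy
  have hy' : y ∈ LinearMap.ker (LinearMap.lsmul R N (b ^ (n + 1))) := by
    simpa [pow_succ', mul_smul] using congrArg Subtype.val hy
  have := (hn (n + 1) n.le_succ).ge hy'
  exact Subtype.ext this

/-- If `a` kills `H^i_𝔪(Y)` for all `i < d`, then a fixed power of `a` kills `Ext^i(N, Y)` for all
finitely generated modules `N` of dimension less than `t` and all `i ≤ d - t`. -/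
lemma exists_pow_smul_ext_eq_zero_of_supportDim_lt [IsLocalRing R] (Y : ModuleCat.{u} R)
    [Module.Finite R Y] (a : R) (d : ℕ)
    (ha : ∀ i < d, ∀ x : (localCohomology (maximalIdeal R) i).obj Y, a • x = 0) (t : ℕ) :
    ∃ k : ℕ, ∀ (N : ModuleCat.{u} R) [Module.Finite R N], Module.supportDim R N < t →
      ∀ i, i + t ≤ d → ∀ e : Abelian.Ext N Y i, a ^ k • e = 0 := by
  have hA : ∃ k : ℕ, ∀ (N : ModuleCat.{u} R) [Module.Finite R N] (s : ℕ),
      maximalIdeal R ^ s ≤ Module.annihilator R N → ∀ i < d, ∀ e : Abelian.Ext N Y i,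
        a ^ k • e = 0 := by
    choose k hk using fun i : Fin d => exists_pow_smul_ext_eq_zero_of_pow_le_annihilator
      (maximalIdeal R) Y a i fun j hj => ha j (hj.trans_lt i.2)
    refine ⟨Finset.univ.sup k, fun N _ s hs i hi e => ?_⟩
    have hle : k ⟨i, hi⟩ ≤ Finset.univ.sup k := Finset.le_sup (Finset.mem_univ _)
    exact pow_smul_eq_zero_of_le hle (hk ⟨i, hi⟩ N s hs e)
  obtain ⟨k₀, hk₀⟩ := hA
  induction t with
  | zero =>
    refine ⟨0, fun N _ hN i _ e => ?_⟩
    have : Subsingleton N := by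
      rw [← Module.supportDim_eq_bot_iff_subsingleton R]
      exact (Order.krullDim_eq_bot_iff.mpr (not_nonempty_iff.mp fun h =>
        hN.not_ge Order.krullDim_nonneg))
    have hid : 𝟙 N = 0 := by ext x; exact Subsingleton.elim _ _
    rw [← Ext.mk₀_id_comp e, hid, Ext.mk₀_zero, Ext.zero_comp, smul_zero]
  | succ t ih =>
    obtain ⟨k, hk⟩ := ih
    refine ⟨max k₀ (k + k), fun N _ hN i hi e => ?_⟩
    obtain ⟨s, hs⟩ | ⟨b, hb, hbN⟩ := exists_pow_maximalIdeal_le_annihilator_or (R := R) N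
    · exact pow_smul_eq_zero_of_le (le_max_left _ _) (hk₀ N s hs i (by omega) e)
    refine pow_smul_eq_zero_of_le (le_max_right _ _) ?_
    obtain ⟨n, hn⟩ := exists_isSMulRegular_range_lsmul (R := R) N b
    let f := (LinearMap.lsmul R N (b ^ n)).rangeRestrict
    rw [pow_add]
    refine ext_smul_eq_zero_of_shortExact (LinearMap.shortExact_shortComplexKer
      (LinearMap.surjective_rangeRestrict (LinearMap.lsmul R N (b ^ n)))) (fun e => ?_)
      (fun e => ?_) e
    · refine hk _ (supportDim_lt_of_pow_smul_eq_zero hbN (Module.support_subset_of_injective _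
        (Submodule.injective_subtype _)) (m := n) ?_ hN) i (by omega) e
      rintro ⟨x, hx⟩
      have hx' : b ^ n • x = 0 := congrArg Subtype.val hx
      exact Subtype.ext hx'
    · refine ext_smul_eq_zero_of_isSMulRegular hb hn (fun m e => ?_) e
      refine hk _ (supportDim_lt_of_pow_smul_eq_zero hbN ((Module.support_subset_of_surjective _
        (Submodule.mkQ_surjective _)).trans (Module.support_subset_of_injective _
        (Submodule.injective_subtype _))) (m := m) ?_ hN) (i + 1) (by omega) e
      intro x
      obtain ⟨x, rfl⟩ := Submodule.mkQ_surjective _ x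
      rw [← map_smul]
      exact (Submodule.Quotient.mk_eq_zero _).mpr (Submodule.smul_mem_pointwise_smul _ _ _ trivial)

end LocalAnnihilation

section LocalizedRegularSequence

open Abelian RingTheory.Sequence TensorProduct

variable {R : Type u} [CommRing R]

lemma ext_smul_eq_zero_of_shortExact_right {S : ShortComplex (ModuleCat.{u} R)} (hS : S.ShortExact)
    {N : ModuleCat.{u} R} {i : ℕ} {c₁ c₂ : R} (h₁ : ∀ e : Abelian.Ext N S.X₁ (i + 1), c₁ • e = 0)
    (h₂ : ∀ e : Abelian.Ext N S.X₂ i, c₂ • e = 0) (e : Abelian.Ext N S.X₃ i) :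
    (c₂ * c₁) • e = 0 := by
  obtain ⟨e', he'⟩ := Ext.covariant_sequence_exact₃ N hS (c₁ • e) rfl
    (by rw [Ext.smul_comp, h₁])
  rw [mul_smul, ← he', ← Ext.smul_comp, h₂, Ext.zero_comp]

lemma smul_ext_eq_zero_of_smul_eq_zero {N Y : ModuleCat.{u} R} {c : R} (h : ∀ y : Y, c • y = 0)
    {i : ℕ} (e : Abelian.Ext N Y i) : c • e = 0 := by
  have hid : c • 𝟙 Y = 0 := by
    ext y
    exact h y
  rw [Ext.smul_eq_comp_mk₀, hid, Ext.mk₀_zero, Ext.comp_zero]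

lemma subsingleton_linearMap_of_smul_ext_zero {N Y : ModuleCat.{u} R} {c : R}
    (hc : ∀ y : Y, c • y = 0 → y = 0) (h : ∀ e : Abelian.Ext N Y 0, c • e = 0) :
    Subsingleton (N →ₗ[R] Y) := by
  refine subsingleton_of_forall_eq 0 fun f => LinearMap.ext fun x => hc _ ?_
  have h0 : Ext.mk₀ (c • ModuleCat.ofHom f) = 0 := (Ext.mk₀_smul c _).trans (h _)
  rw [← Ext.mk₀_zero] at h0
  have h1 : c • ModuleCat.ofHom f = 0 := Ext.homEquiv₀.symm.injective h0
  exact LinearMap.congr_fun (congrArg ModuleCat.Hom.hom h1) x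

lemma exists_smul_eq_zero_of_forall_exists (S : Submonoid R) {M : Type*} [AddCommGroup M]
    [Module R M] [Module.Finite R M] (h : ∀ x : M, ∃ c ∈ S, c • x = 0) :
    ∃ c ∈ S, ∀ x : M, c • x = 0 := by
  obtain ⟨s, hs⟩ := Module.Finite.fg_top (R := R) (M := M)
  classical
  choose c hcS hc using h
  refine ⟨∏ x ∈ s, c x, prod_mem fun x _ => hcS x, fun x => ?_⟩
  have hx : x ∈ Submodule.span R (s : Set M) := hs ▸ trivial
  induction hx using Submodule.span_induction with
  | mem x hx =>
    rw [← Finset.prod_erase_mul s c hx, mul_smul, hc, smul_zero]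
  | zero => exact smul_zero _
  | add x y _ _ hx hy => rw [smul_add, hx, hy, add_zero]
  | smul r x _ hx => rw [smul_comm, hx, smul_zero]

lemma lTensor_mkQ_bijective_of_smul_eq_zero (A : Type*) [CommRing A] [Algebra R A]
    {M : Type*} [AddCommGroup M] [Module R M] (K : Submodule R M) {c : R}
    (hc : IsUnit (algebraMap R A c)) (hK : ∀ x ∈ K, c • x = 0) :
    Function.Bijective (LinearMap.lTensor A K.mkQ) := by
  refine ⟨?_, LinearMap.lTensor_surjective A K.mkQ_surjective⟩
  have hex : Function.Exact K.subtype K.mkQ := LinearMap.exact_subtype_mkQ K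
  have := lTensor_exact A hex K.mkQ_surjective
  rw [← LinearMap.ker_eq_bot, this.linearMap_ker_eq, LinearMap.range_eq_bot]
  ext a x
  obtain ⟨b, hb⟩ := hc
  have : a = c • (↑b⁻¹ * a) := by
    rw [Algebra.smul_def, ← hb, Units.mul_inv_cancel_left]
  simp only [TensorProduct.AlgebraTensorModule.curry_apply, LinearMap.restrictScalars_self,
    TensorProduct.curry_apply, LinearMap.lTensor_tmul, LinearMap.zero_apply]
  rw [this, smul_tmul, Submodule.subtype_apply, hK x x.2, tmul_zero]

/-- If for each `i < s` some element outside the prime `p` kills `Ext^i(R/p, Y)`, then `p` contains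
a sequence of length `s` which is weakly regular on `Y_p`. -/
lemma exists_isWeaklyRegular_tensorProduct_of_ext [IsNoetherianRing R] (p : Ideal R) [p.IsPrime]
    (A : Type*) [CommRing A] [Algebra R A] [IsLocalization.AtPrime A p] (s : ℕ)
    (Y : ModuleCat.{u} R) [Module.Finite R Y]
    (h : ∀ i < s, ∃ c ∈ p.primeCompl,
      ∀ e : Abelian.Ext (ModuleCat.of R (R ⧸ p)) Y i, c • e = 0) :
    ∃ rs : List R, rs.length = s ∧ (∀ r ∈ rs, r ∈ p) ∧ IsWeaklyRegular (A ⊗[R] Y) rs := by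
  induction s generalizing Y with
  | zero => exact ⟨[], rfl, by simp, .nil _ _⟩
  | succ s ih =>
    let K : Submodule R Y := Submodule.torsion' R Y p.primeCompl
    obtain ⟨c₀, hc₀, hK⟩ := exists_smul_eq_zero_of_forall_exists p.primeCompl (M := K) fun x => by
      obtain ⟨c, hc⟩ := (Submodule.mem_torsion'_iff _ _).mp x.2
      exact ⟨c, c.2, Subtype.ext hc⟩
    have hK' (x) (hx : x ∈ K) : c₀ • x = 0 := congrArg Subtype.val (hK ⟨x, hx⟩)
    have hKer (x : LinearMap.ker K.mkQ) : c₀ • x = 0 :=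
      Subtype.ext (hK' x (K.ker_mkQ.le x.2))
    let Y' : ModuleCat.{u} R := ModuleCat.of R (Y ⧸ K)
    have hY' : ∀ i < s + 1, ∃ c ∈ p.primeCompl,
        ∀ e : Abelian.Ext (ModuleCat.of R (R ⧸ p)) Y' i, c • e = 0 := by
      intro i hi
      obtain ⟨c, hc, he⟩ := h i hi
      exact ⟨c * c₀, mul_mem hc hc₀, ext_smul_eq_zero_of_shortExact_right
        (LinearMap.shortExact_shortComplexKer K.mkQ_surjective)
        (fun e => smul_ext_eq_zero_of_smul_eq_zero hKer e) he⟩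
    obtain ⟨x, hxp, hx⟩ : ∃ x ∈ p, IsSMulRegular Y' x := by
      obtain ⟨c, hc, he⟩ := hY' 0 s.succ_pos
      have := subsingleton_linearMap_of_smul_ext_zero (fun y hy => ?_) he
      · rw [← Ideal.annihilator_quotient (I := p)]
        exact IsSMulRegular.subsingleton_linearMap_iff.mp this
      · obtain ⟨y, rfl⟩ := K.mkQ_surjective y
        rw [← map_smul] at hy
        have hy' : c₀ • c • y = 0 := hK' _ ((Submodule.Quotient.mk_eq_zero K).mp hy)
        refine (Submodule.Quotient.mk_eq_zero K).mpr ((Submodule.mem_torsion'_iff _ _).mpr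
          ⟨⟨c₀ * c, mul_mem hc₀ hc⟩, ?_⟩)
        exact (mul_smul c₀ c y).trans hy'
    obtain ⟨rs, hlen, hrs, hreg⟩ := ih (ModuleCat.of R (QuotSMulTop x Y')) fun i hi => by
      obtain ⟨c₁, hc₁, h₁⟩ := hY' (i + 1) (by omega)
      obtain ⟨c₂, hc₂, h₂⟩ := hY' i (by omega)
      exact ⟨c₂ * c₁, mul_mem hc₂ hc₁,
        ext_smul_eq_zero_of_shortExact_right hx.smulShortComplex_shortExact h₁ h₂⟩
    refine ⟨x :: rs, by simp [hlen], by simpa using ⟨hxp, hrs⟩, ?_⟩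
    have := IsLocalization.flat A p.primeCompl
    rw [(LinearEquiv.ofBijective _ (lTensor_mkQ_bijective_of_smul_eq_zero A K
      (IsLocalization.map_units A (⟨c₀, hc₀⟩ : p.primeCompl)) hK')).isWeaklyRegular_congr]
    exact (((QuotSMulTop.tensorQuotSMulTopEquivQuotSMulTop x A Y').isWeaklyRegular_congr
      rs).mp hreg).cons (hx.lTensor A)

end LocalizedRegularSequence

section Dimension

open IsLocalRing RingTheory.Sequence

lemma dimMod_eq_supportDim (R M : Type) [CommRing R] [AddCommGroup M] [Module R M]
    [Module.Finite R M] : Paper.dimMod R M = Module.supportDim R M :=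
  Order.krullDim_eq_of_orderIso
    { toFun q := ⟨⟨q.1, q.2.1⟩, Module.mem_support_iff_of_finite.mpr q.2.2⟩
      invFun q := ⟨q.1.asIdeal, q.1.2, Module.mem_support_iff_of_finite.mp q.2⟩
      left_inv _ := rfl
      right_inv _ := rfl
      map_rel_iff' := Iff.rfl }

lemma annihilator_le_comap_of_mem_support_localizedModule {R : Type*} [CommRing R]
    (S : Submonoid R) {M : Type*} [AddCommGroup M] [Module R M]
    {q : PrimeSpectrum (Localization S)}
    (hq : q ∈ Module.support (Localization S) (LocalizedModule S M)) :
    Module.annihilator R M ≤ q.asIdeal.comap (algebraMap R (Localization S)) := by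
  intro r hr
  refine Module.annihilator_le_of_mem_support hq (Module.mem_annihilator.mpr fun x => ?_)
  induction x using LocalizedModule.induction_on with
  | h m s => rw [algebraMap_smul, LocalizedModule.smul'_mk, Module.mem_annihilator.mp hr,
      LocalizedModule.zero_mk]

/-- The dimensions of `M_p` and of `R/p` add up to at most the dimension of `M`. -/
lemma supportDim_localizedModule_add_supportDim_quotient_le {R : Type*} [CommRing R]
    (M : Type*) [AddCommGroup M] [Module R M] [Module.Finite R M] (p : Ideal R) [hp : p.IsPrime]
    (hpM : Module.annihilator R M ≤ p) :
    Module.supportDim (Localization.AtPrime p) (LocalizedModule p.primeCompl M) +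
      Module.supportDim R (R ⧸ p) ≤ Module.supportDim R M := by
  let P : Module.support R M := ⟨⟨p, hp⟩, Module.mem_support_iff_of_finite.mpr hpM⟩
  have h₁ : Module.supportDim (Localization.AtPrime p) (LocalizedModule p.primeCompl M) ≤
      (Order.height P : WithBot ℕ∞) := by
    rw [Order.height_eq_krullDim_Iic]
    refine Order.krullDim_le_of_strictMono (fun q => ⟨⟨q.1.comap (algebraMap R _),
      Module.mem_support_iff_of_finite.mpr
        (annihilator_le_comap_of_mem_support_localizedModule _ q.2)⟩, ?_⟩) fun q q' hqq' => ?_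
    · change q.1.asIdeal.comap (algebraMap R _) ≤ p
      exact (Ideal.comap_mono (le_maximalIdeal q.1.2.ne_top)).trans
        (Localization.AtPrime.under_maximalIdeal).le
    · exact (IsLocalization.orderEmbedding p.primeCompl (Localization.AtPrime p)).strictMono hqq'
  have h₂ : Module.supportDim R (R ⧸ p) ≤ (Order.coheight P : WithBot ℕ∞) := by
    rw [Order.coheight_eq_krullDim_Ici]
    have hle (q : Module.support R (R ⧸ p)) : p ≤ q.1.asIdeal := by
      simpa [Ideal.annihilator_quotient] using Module.mem_support_iff_of_finite.mp q.2
    exact Order.krullDim_le_of_strictMono (fun q => ⟨⟨q.1, Module.mem_support_iff_of_finite.mpr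
      (hpM.trans (hle q))⟩, hle q⟩) fun _ _ h => h
  have : Nonempty (Module.support R M) := ⟨P⟩
  refine (add_le_add h₁ h₂).trans ?_
  rw [Module.supportDim, Order.krullDim_eq_iSup_height_add_coheight_of_nonempty]
  exact_mod_cast le_iSup (fun a : Module.support R M => Order.height a + Order.coheight a) P

lemma exists_supportDim_eq_natCast (R M : Type*) [CommRing R] [FiniteRingKrullDim R]
    [AddCommGroup M] [Module R M] [Nontrivial M] : ∃ n : ℕ, Module.supportDim R M = n := by
  have h₁ := Module.supportDim_ne_bot_of_nontrivial R M
  have h₂ := (Module.supportDim_le_ringKrullDim R M).trans_lt (ringKrullDim_lt_top)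
  generalize Module.supportDim R M = A at h₁ h₂
  cases A with
  | bot => exact absurd rfl h₁
  | coe A =>
    cases A with
    | top => exact absurd h₂ (lt_irrefl _)
    | coe A => exact ⟨A, rfl⟩

lemma depthOn_le_supportDim {R M : Type} [CommRing R] [IsNoetherianRing R] [IsLocalRing R]
    [AddCommGroup M] [Module R M] [Module.Finite R M] {n : ℕ} (hn : Module.supportDim R M = n) :
    Paper.depthOn R (maximalIdeal R) M ≤ n := by
  refine iSup₂_le fun rs hrs => ?_
  have := hrs.2.quot_ofList_smul_nontrivial ⊤
  have h := Module.supportDim_add_length_eq_supportDim_of_isRegular rs hrs.2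
  obtain ⟨k, hk⟩ := exists_supportDim_eq_natCast R (M ⧸ Ideal.ofList rs • (⊤ : Submodule R M))
  rw [hn, hk] at h
  norm_cast at h ⊢
  omega

lemma isCMLocalMod_of_isWeaklyRegular {R M : Type} [CommRing R] [IsNoetherianRing R]
    [IsLocalRing R] [AddCommGroup M] [Module R M] [Module.Finite R M] [Nontrivial M]
    {rs : List R} (hrs : ∀ r ∈ rs, r ∈ maximalIdeal R) (hreg : IsWeaklyRegular M rs)
    (hlen : Module.supportDim R M = rs.length) : Paper.IsCMLocalMod R M := by
  have h : (rs.length : ℕ∞) ≤ Paper.depthOn R (maximalIdeal R) M :=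
    le_iSup₂_of_le (f := fun (l : List R) _ => (l.length : ℕ∞)) rs
      ⟨hrs, (isRegular_iff_isWeaklyRegular_of_subset_maximalIdeal hrs).mpr hreg⟩ le_rfl
  rw [Paper.IsCMLocalMod, dimMod_eq_supportDim, (depthOn_le_supportDim hlen).antisymm h, hlen]
  rfl

end Dimension

/-- If `M_p` is not Cohen–Macaulay for a prime `p` in the support of the finitely
generated module `M` over a Noetherian local ring, then
`a(M) = ⋂_{i < dim M} Ann H^i_m(M)` is contained in `p`. -/
theorem aM_le_of_not_CM (R : Type) [CommRing R] [IsNoetherianRing R] [IsLocalRing R]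
    (M : Type) [AddCommGroup M] [Module R M] [Module.Finite R M]
    (p : Ideal R) [p.IsPrime] (hpsupp : p ∈ Paper.supp R M)
    (hnotCM : ¬ Paper.IsCMLocalMod (Localization.AtPrime p)
        (LocalizedModule p.primeCompl M)) :
    ⨅ i ∈ {i : ℕ | (i : WithBot ℕ∞) < Paper.dimMod R M},
      Module.annihilator R (Paper.H R (IsLocalRing.maximalIdeal R) i M) ≤ p := by
  obtain ⟨hp, hpM⟩ := hpsupp
  intro a ha
  by_contra hap
  have hMp : Nontrivial (LocalizedModule p.primeCompl M) :=
    (Module.mem_support_iff_of_finite (p := ⟨p, hp⟩)).mpr hpM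
  have hM : Nontrivial M := Module.nonempty_support_iff.mp
    ⟨⟨p, hp⟩, Module.mem_support_iff_of_finite.mpr hpM⟩
  have : Nontrivial (R ⧸ p) := Ideal.Quotient.nontrivial_iff.mpr hp.ne_top
  obtain ⟨d, hd⟩ := exists_supportDim_eq_natCast R M
  obtain ⟨δ, hδ⟩ := exists_supportDim_eq_natCast R (R ⧸ p)
  obtain ⟨s, hs⟩ := exists_supportDim_eq_natCast (Localization.AtPrime p)
    (LocalizedModule p.primeCompl M)
  have hle := supportDim_localizedModule_add_supportDim_quotient_le M p hpM
  rw [hd, hδ, hs] at hle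
  norm_cast at hle
  obtain ⟨k, hk⟩ := exists_pow_smul_ext_eq_zero_of_supportDim_lt (ModuleCat.of R M) a d
    (fun i hi x => by
      refine Module.mem_annihilator.mp ((Submodule.mem_iInf _).mp ((Submodule.mem_iInf _).mp ha i)
        ?_) x
      change (i : WithBot ℕ∞) < Paper.dimMod R M
      rw [dimMod_eq_supportDim, hd]
      exact_mod_cast hi) (δ + 1)
  obtain ⟨rs, hlen, hrs, hreg⟩ := exists_isWeaklyRegular_tensorProduct_of_ext p
    (Localization.AtPrime p) s (ModuleCat.of R M) fun i hi =>
      ⟨a ^ k, pow_mem (S := p.primeCompl) hap k, hk (ModuleCat.of R (R ⧸ p))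
        (hδ.trans_lt (by exact_mod_cast δ.lt_succ_self)) i (by omega)⟩
  refine hnotCM (isCMLocalMod_of_isWeaklyRegular
    (rs := rs.map (algebraMap R (Localization.AtPrime p))) ?_ ?_
    (by rw [hs, List.length_map, hlen]))
  · intro x hx
    obtain ⟨r, hr, rfl⟩ := List.mem_map.mp hx
    exact (IsLocalization.AtPrime.to_map_mem_maximal_iff _ p r).mpr (hrs r hr)
  · rw [RingTheory.Sequence.isWeaklyRegular_map_algebraMap_iff]
    exact (((LocalizedModule.equivTensorProduct p.primeCompl M).restrictScalars
      R).isWeaklyRegular_congr rs).mpr hreg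
end
end

section
/- Let (R,𝔪) be a Noetherian local ring and x a uniform local cohomological annihilator of a finitely generated R-module M. Then the localization M_x is a Cohen–Macaulay R_x-module, i.e., for every prime 𝔭 ∈ Supp M with x ∉ 𝔭, the module M_𝔭 is Cohen–Macaulay over R_𝔭. -/
noncomputable section
open CategoryTheory

namespace Paper

section
open Limits
variable {D : Type*} [Category D] [Abelian D] {ι : Type*} {c : ComplexShape ι}

/-- The map out of the homology of `K` induced by a map out of `K.X j` which vanishes on
boundaries. -/
noncomputable def homologyDesc (K : HomologicalComplex D c) {j : ι} {A : D} (k : K.X j ⟶ A)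
    (hk : K.d (c.prev j) j ≫ k = 0) : K.homology j ⟶ A :=
  K.homologyι j ≫ K.descOpcycles k (c.prev j) rfl hk

lemma homologyMap_homologyDesc {K L : HomologicalComplex D c} (φ : K ⟶ L) {j : ι} {A : D}
    (k : L.X j ⟶ A) (hk : L.d (c.prev j) j ≫ k = 0) :
    HomologicalComplex.homologyMap φ j ≫ homologyDesc L k hk =
      homologyDesc K (φ.f j ≫ k) (by rw [← φ.comm_assoc, hk, comp_zero]) := by
  unfold homologyDesc
  rw [HomologicalComplex.homologyι_naturality_assoc]
  congr 1
  rw [← cancel_epi (K.pOpcycles j)]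
  simp

lemma homologyDesc_comp (K : HomologicalComplex D c) {j : ι} {A B : D} (k : K.X j ⟶ A)
    (hk : K.d (c.prev j) j ≫ k = 0) (a : A ⟶ B) :
    homologyDesc K k hk ≫ a = homologyDesc K (k ≫ a) (by rw [← Category.assoc, hk, zero_comp]) := by
  unfold homologyDesc
  rw [Category.assoc]
  congr 1
  rw [← cancel_epi (K.pOpcycles j)]
  simp

lemma exists_of_homologyDesc_eq_zero (K : HomologicalComplex D c) {j : ι} {A : D} [Injective A]
    (k : K.X j ⟶ A) (hk : K.d (c.prev j) j ≫ k = 0) (h : homologyDesc K k hk = 0) :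
    ∃ v : K.X (c.next j) ⟶ A, K.d j (c.next j) ≫ v = k := by
  have ex : (ShortComplex.mk _ _ (K.homologyι_comp_fromOpcycles j (c.next j))).Exact :=
    ShortComplex.exact_of_f_is_kernel _ (K.homologyIsKernel j _ rfl)
  refine ⟨ex.descToInjective _ h, ?_⟩
  rw [← K.p_fromOpcycles, Category.assoc]
  erw [ex.comp_descToInjective]
  simp
end

section
open Opposite
variable {R : Type} [CommRing R]

/-- The additive functor `Hom(-, M)`, with values in the opposite category. -/
noncomputable abbrev homTo (M : ModuleCat.{0} R) : ModuleCat.{0} R ⥤ (ModuleCat.{0} R)ᵒᵖ :=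
  ((linearYoneda R (ModuleCat.{0} R)).obj M).rightOp

variable {X Y M : ModuleCat.{0} R}

/-- The complex of homomorphisms from a projective resolution. -/
noncomputable abbrev homComplex (P : ProjectiveResolution X) (M : ModuleCat.{0} R) :
    ChainComplex (ModuleCat.{0} R)ᵒᵖ ℕ :=
  ((homTo M).mapHomologicalComplex _).obj P.complex

/-- A homomorphism from a term of a projective resolution, seen as a map from `R`. -/
noncomputable def cochainMap (P : ProjectiveResolution X) {n : ℕ} (f : P.complex.X n ⟶ M) :
    (homComplex P M).X n ⟶ op (ModuleCat.of R R) :=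
  Quiver.Hom.op (X := ModuleCat.of R R) (Y := ModuleCat.of R (P.complex.X n ⟶ M))
    (ModuleCat.ofHom (LinearMap.toSpanSingleton R (P.complex.X n ⟶ M) f))

lemma d_cochainMap (P : ProjectiveResolution X) {n m : ℕ} (f : P.complex.X n ⟶ M) :
    (homComplex P M).d m n ≫ cochainMap P f = cochainMap P (P.complex.d m n ≫ f) := by
  apply Quiver.Hom.unop_inj
  apply ModuleCat.hom_ext
  apply LinearMap.ext_ring
  change P.complex.d m n ≫ ((1 : R) • f) = (1 : R) • (P.complex.d m n ≫ f)
  simp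

lemma cochainMap_injective (P : ProjectiveResolution X) {n : ℕ} {f g : P.complex.X n ⟶ M}
    (h : cochainMap P f = cochainMap P g) : f = g := by
  have := congrArg (fun φ ↦ φ.unop.hom (1 : R)) h
  change (1 : R) • f = (1 : R) • g at this
  simpa using this

lemma cochainMap_surjective (P : ProjectiveResolution X) {n : ℕ}
    (v : (homComplex P M).X n ⟶ op (ModuleCat.of R R)) :
    ∃ f : P.complex.X n ⟶ M, cochainMap P f = v := by
  refine ⟨v.unop.hom (1 : R), ?_⟩
  apply Quiver.Hom.unop_inj
  apply ModuleCat.hom_ext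
  apply LinearMap.ext_ring
  exact one_smul R (_ : P.complex.X n ⟶ M)

lemma cochainMap_zero (P : ProjectiveResolution X) {n : ℕ} :
    cochainMap P (0 : P.complex.X n ⟶ M) = 0 := by
  apply Quiver.Hom.unop_inj
  apply ModuleCat.hom_ext
  apply LinearMap.ext_ring
  exact smul_zero (A := P.complex.X n ⟶ M) (1 : R)

lemma d_prev_cochainMap (P : ProjectiveResolution X) {n : ℕ} (f : P.complex.X n ⟶ M)
    (hf : P.complex.d (n + 1) n ≫ f = 0) :
    (homComplex P M).d ((ComplexShape.down ℕ).prev n) n ≫ cochainMap P f = 0 := by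
  have h : (ComplexShape.down ℕ).prev n = n + 1 := by simp
  rw [d_cochainMap, h, hf, cochainMap_zero]

/-- Left derived functors of `Hom(-, M)` are computed by projective resolutions. -/
noncomputable def leftDerivedIso (P : ProjectiveResolution X) (M : ModuleCat.{0} R) (n : ℕ) :
    ((homTo M).leftDerived n).obj X ≅ (homComplex P M).homology n :=
  P.isoLeftDerivedObj (homTo M) n

lemma leftDerivedIso_naturality {g : X ⟶ Y} {P : ProjectiveResolution X}
    {Q : ProjectiveResolution Y} (φ : ProjectiveResolution.Hom P Q g) (n : ℕ) :
    ((homTo M).leftDerived n).map g ≫ (leftDerivedIso Q M n).hom =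
      (leftDerivedIso P M n).hom ≫ HomologicalComplex.homologyMap
        (((homTo M).mapHomologicalComplex _).map φ.hom) n :=
  ProjectiveResolution.isoLeftDerivedObj_hom_naturality g P Q φ.hom
    φ.hom_f_zero_comp_π_f_zero _ n

/-- The class, in the derived functor of `Hom(-, M)`, of a cocycle on a projective resolution,
seen as a map from `R`. -/
noncomputable def derivedClass (P : ProjectiveResolution X) {n : ℕ} (f : P.complex.X n ⟶ M)
    (hf : P.complex.d (n + 1) n ≫ f = 0) :
    ((homTo M).leftDerived n).obj X ⟶ op (ModuleCat.of R R) :=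
  (leftDerivedIso P M n).hom ≫
    homologyDesc (homComplex P M) (cochainMap P f) (d_prev_cochainMap P f hf)

lemma map_derivedClass {g : X ⟶ Y} {P : ProjectiveResolution X} {Q : ProjectiveResolution Y}
    (φ : ProjectiveResolution.Hom P Q g) {n : ℕ} (f : Q.complex.X n ⟶ M)
    (hf : Q.complex.d (n + 1) n ≫ f = 0) :
    ((homTo M).leftDerived n).map g ≫ derivedClass Q f hf =
      derivedClass P (φ.hom.f n ≫ f) (by simp [← φ.hom.comm_assoc, hf]) := by
  unfold derivedClass
  rw [← Category.assoc, leftDerivedIso_naturality φ, Category.assoc, homologyMap_homologyDesc]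
  rfl

lemma extMk_eq_zero_of_derivedClass_eq_zero (P : ProjectiveResolution X) {n : ℕ}
    (f : P.complex.X n ⟶ M) (hf : P.complex.d (n + 1) n ≫ f = 0)
    (h : derivedClass P f hf = 0) : P.extMk f (n + 1) rfl hf = 0 := by
  have h' : homologyDesc (homComplex P M) (cochainMap P f) (d_prev_cochainMap P f hf) = 0 := by
    unfold derivedClass at h
    exact (cancel_epi (leftDerivedIso P M n).hom).1 (by rw [h, Limits.comp_zero])
  obtain ⟨v, hv⟩ := exists_of_homologyDesc_eq_zero _ _ _ h'
  obtain ⟨w, rfl⟩ := cochainMap_surjective P v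
  rw [d_cochainMap] at hv
  have hw := cochainMap_injective P hv
  obtain _ | n := n
  · rw [P.complex.shape _ _ (by simp), Limits.zero_comp] at hw
    subst hw
    simp
  · have e : (ComplexShape.down ℕ).next (n + 1) = n := by simp
    rw [P.extMk_eq_zero_iff f _ rfl hf n rfl]
    clear hv
    revert w
    rw [e]
    exact fun w hw ↦ ⟨w, hw⟩

/-- The class in `Ext` of a cocycle on a projective resolution. -/
noncomputable def extClassOf (P : ProjectiveResolution X) {n : ℕ} (f : P.complex.X n ⟶ M)
    (hf : P.complex.d (n + 1) n ≫ f = 0) :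
    ((Ext R (ModuleCat.{0} R) n).obj (op X)).obj M :=
  (derivedClass P f hf).unop.hom (1 : R)

lemma derivedClass_smul (P : ProjectiveResolution X) {n : ℕ} (f : P.complex.X n ⟶ M)
    (hf : P.complex.d (n + 1) n ≫ f = 0) (r : R) :
    derivedClass P (r • f) (by simp [hf]) =
      derivedClass P f hf ≫ (ModuleCat.ofHom (r • LinearMap.id)).op := by
  unfold derivedClass
  rw [Category.assoc, homologyDesc_comp]
  congr 2
  apply Quiver.Hom.unop_inj
  apply ModuleCat.hom_ext
  apply LinearMap.ext_ring
  change (1 : R) • (r • f) = (r • (1 : R)) • f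
  simp

lemma extClassOf_smul (P : ProjectiveResolution X) {n : ℕ} (f : P.complex.X n ⟶ M)
    (hf : P.complex.d (n + 1) n ≫ f = 0) (r : R) :
    extClassOf P (r • f) (by simp [hf]) = r • extClassOf P f hf := by
  unfold extClassOf
  rw [derivedClass_smul P f hf]
  change (derivedClass P f hf).unop.hom (r • (1 : R)) = _
  rw [map_smul]
  rfl

lemma map_extClassOf {g : X ⟶ Y} {P : ProjectiveResolution X} {Q : ProjectiveResolution Y}
    (φ : ProjectiveResolution.Hom P Q g) {n : ℕ} (f : Q.complex.X n ⟶ M)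
    (hf : Q.complex.d (n + 1) n ≫ f = 0) :
    (((Ext R (ModuleCat.{0} R) n).map g.op).app M).hom (extClassOf Q f hf) =
      extClassOf P (φ.hom.f n ≫ f) (by simp [← φ.hom.comm_assoc, hf]) := by
  unfold extClassOf
  rw [← map_derivedClass φ f hf]
  rfl

lemma extMk_eq_zero_of_extClassOf_eq_zero (P : ProjectiveResolution X) {n : ℕ}
    (f : P.complex.X n ⟶ M) (hf : P.complex.d (n + 1) n ≫ f = 0)
    (h : extClassOf P f hf = 0) : P.extMk f (n + 1) rfl hf = 0 := by
  apply extMk_eq_zero_of_derivedClass_eq_zero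
  apply Quiver.Hom.unop_inj
  apply ModuleCat.hom_ext
  apply LinearMap.ext_ring
  exact h

end

section
open Opposite Limits
variable {R : Type} [CommRing R]

/-- The projection `R/I^s → R/I^t`. -/
abbrev powQuotMap (I : Ideal R) {s t : ℕ} (h : t ≤ s) :
    ModuleCat.of R (R ⧸ I ^ s) ⟶ ModuleCat.of R (R ⧸ I ^ t) :=
  ModuleCat.ofHom (Submodule.mapQ _ _ LinearMap.id (Ideal.pow_le_pow_right h))

lemma exists_map_eq_zero_of_localCohomology (I : Ideal R) (n : ℕ) (M : ModuleCat.{0} R) (r : R)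
    (hr : ∀ y : (localCohomology I n).obj M, r • y = 0) (t : ℕ)
    (z : ((Ext R (ModuleCat.{0} R) n).obj (op (ModuleCat.of R (R ⧸ I ^ t)))).obj M) :
    ∃ (s : ℕ) (h : t ≤ s),
      (((Ext R (ModuleCat.{0} R) n).map (powQuotMap I h).op).app M).hom (r • z) = 0 := by
  let D := localCohomology.diagram (localCohomology.idealPowersDiagram I) n
  let hD := isColimitOfPreserves ((evaluation (ModuleCat.{0} R) (ModuleCat.{0} R)).obj M)
    (colimit.isColimit D)
  have h0 : ((colimit.ι D (op (op t))).app M).hom (r • z) =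
      ((colimit.ι D (op (op t))).app M).hom 0 := by
    refine Eq.trans ?_ (map_zero _).symm
    refine Eq.trans (map_smul ((colimit.ι D (op (op t))).app M).hom r z) ?_
    exact hr _
  obtain ⟨k, f, g, e⟩ := Concrete.isColimit_exists_of_rep_eq _ hD (i := op (op t))
    (j := op (op t)) (r • z) 0 h0
  refine ⟨k.unop.unop, f.unop.unop.down.down, ?_⟩
  refine Eq.trans e ?_
  exact map_zero _

theorem exists_comp_eq_zero_of_localCohomology (I : Ideal R) (n : ℕ) (M : ModuleCat.{0} R) (r : R)
    (hr : ∀ y : (localCohomology I n).obj M, r • y = 0) (t : ℕ)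
    (z : Abelian.Ext (ModuleCat.of R (R ⧸ I ^ t)) M n) :
    ∃ (s : ℕ) (h : t ≤ s),
      (Abelian.Ext.mk₀ (powQuotMap I h)).comp (r • z) (zero_add n) = 0 := by
  let Q := ProjectiveResolution.of (ModuleCat.of R (R ⧸ I ^ t))
  obtain ⟨f, hf, rfl⟩ := Q.extMk_surjective z (n + 1) rfl
  obtain ⟨s, h, hs⟩ := exists_map_eq_zero_of_localCohomology I n M r hr t (extClassOf Q f hf)
  refine ⟨s, h, ?_⟩
  let P := ProjectiveResolution.of (ModuleCat.of R (R ⧸ I ^ s))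
  let φ : ProjectiveResolution.Hom P Q (powQuotMap I h) :=
    { hom := ProjectiveResolution.lift (powQuotMap I h) P Q
      hom_f_zero_comp_π_f_zero :=
        ProjectiveResolution.lift_commutes_zero (powQuotMap I h) P Q }
  rw [← extClassOf_smul, map_extClassOf φ] at hs
  rw [Abelian.Ext.smul_eq_comp_mk₀, Q.extMk_comp_mk₀]
  rw [Q.mk₀_comp_extMk _ _ _ _ φ]
  have := extMk_eq_zero_of_extClassOf_eq_zero P _ _ hs
  simpa using this

end

section
variable {R : Type} [CommRing R] {A B C X M N P : Type}
  [AddCommGroup A] [Module R A] [AddCommGroup B] [Module R B] [AddCommGroup C] [Module R C]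
  [AddCommGroup X] [Module R X]
  [AddCommGroup M] [Module R M] [AddCommGroup N] [Module R N] [AddCommGroup P] [Module R P]

variable (R) in
/-- The module `Ext^n(A, M)`. -/
noncomputable abbrev ExtMod (A M : Type) [AddCommGroup A] [Module R A] [AddCommGroup M] [Module R M]
    (n : ℕ) : Type :=
  Abelian.Ext (ModuleCat.of R A) (ModuleCat.of R M) n

/-- Functoriality of `Ext` in the first variable. -/
noncomputable def extPre (f : A →ₗ[R] B) (M : Type) [AddCommGroup M] [Module R M] (n : ℕ) :
    ExtMod R B M n →ₗ[R] ExtMod R A M n where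
  toFun z := (Abelian.Ext.mk₀ (ModuleCat.ofHom f)).comp z (zero_add n)
  map_add' := by simp
  map_smul' := by simp

/-- Functoriality of `Ext` in the second variable. -/
noncomputable def extPost (A : Type) [AddCommGroup A] [Module R A] (f : M →ₗ[R] N) (n : ℕ) :
    ExtMod R A M n →ₗ[R] ExtMod R A N n where
  toFun z := z.comp (Abelian.Ext.mk₀ (ModuleCat.ofHom f)) (add_zero n)
  map_add' := by simp
  map_smul' := by simp

lemma extPre_extPre (f : A →ₗ[R] B) (g : B →ₗ[R] C) {n : ℕ} (z : ExtMod R C M n) :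
    extPre f M n (extPre g M n z) = extPre (g ∘ₗ f) M n z := by
  simp [extPre, ModuleCat.ofHom_comp]

@[simp]
lemma extPre_id {n : ℕ} (z : ExtMod R A M n) : extPre (LinearMap.id : A →ₗ[R] A) M n z = z := by
  simp [extPre, ModuleCat.ofHom_id]

lemma extPre_sum {ι : Type} (s : Finset ι) (f : ι → A →ₗ[R] B) {n : ℕ} (z : ExtMod R B M n) :
    extPre (∑ i ∈ s, f i) M n z = ∑ i ∈ s, extPre (f i) M n z := by
  classical
  induction s using Finset.induction_on with
  | empty =>
    simp [extPre, show ModuleCat.ofHom (0 : A →ₗ[R] B) = 0 from rfl]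
  | insert i s hi ih =>
    rw [Finset.sum_insert hi, Finset.sum_insert hi, ← ih]
    simp only [extPre, ModuleCat.ofHom_add, LinearMap.coe_mk, AddHom.coe_mk]
    rw [Abelian.Ext.mk₀_add, Abelian.Ext.add_comp]

lemma extPre_smul_id (r : R) {n : ℕ} (z : ExtMod R A M n) :
    extPre (r • (LinearMap.id : A →ₗ[R] A)) M n z = r • z := by
  have : ModuleCat.ofHom (r • (LinearMap.id : A →ₗ[R] A)) = r • 𝟙 (ModuleCat.of R A) := rfl
  simp [extPre, this, Abelian.Ext.mk₀_smul]

lemma extPost_smul_id (r : R) {n : ℕ} (z : ExtMod R A M n) :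
    extPost A (r • (LinearMap.id : M →ₗ[R] M)) n z = r • z := by
  have : ModuleCat.ofHom (r • (LinearMap.id : M →ₗ[R] M)) = r • 𝟙 (ModuleCat.of R M) := rfl
  simp [extPost, this, Abelian.Ext.mk₀_smul]

lemma smul_extMod_eq_zero_of_right (r : R) (h : ∀ a : M, r • a = 0) {n : ℕ} (z : ExtMod R A M n) :
    r • z = 0 := by
  have e : r • (LinearMap.id : M →ₗ[R] M) = 0 := by ext; simp [h]
  rw [← extPost_smul_id, e]
  simp [extPost, show ModuleCat.ofHom (0 : M →ₗ[R] M) = 0 from rfl]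

/-- A class on a finite power which vanishes on all summands is zero. -/
lemma eq_zero_of_extPre_single {ι : Type} [Fintype ι] [DecidableEq ι] {n : ℕ}
    (z : ExtMod R (ι → A) M n) (h : ∀ i, extPre (LinearMap.single R (fun _ ↦ A) i) M n z = 0) :
    z = 0 := by
  have e : (LinearMap.id : (ι → A) →ₗ[R] (ι → A)) =
      ∑ i, LinearMap.single R (fun _ ↦ A) i ∘ₗ LinearMap.proj i := by
    ext i a j
    simp [Pi.single_apply]
  rw [← extPre_id z, e, extPre_sum]
  refine Finset.sum_eq_zero fun i _ ↦ ?_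
  rw [← extPre_extPre, h, map_zero]

section exact
variable {f : A →ₗ[R] B} {g : B →ₗ[R] C}

lemma shortExact_of_exact (hf : Function.Injective f) (hg : Function.Surjective g)
    (hfg : Function.Exact f g) :
    (ShortComplex.mk (ModuleCat.ofHom f) (ModuleCat.ofHom g)
      (by ext a; exact hfg.apply_apply_eq_zero a)).ShortExact where
  exact := (ShortComplex.ShortExact.moduleCat_exact_iff_function_exact _).2 hfg
  mono_f := (ModuleCat.mono_iff_injective _).2 hf
  epi_g := (ModuleCat.epi_iff_surjective _).2 hg

lemma exists_extPre_eq (hf : Function.Injective f) (hg : Function.Surjective g)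
    (hfg : Function.Exact f g) {n : ℕ} (z : ExtMod R B M n) (hz : extPre f M n z = 0) :
    ∃ w, extPre g M n w = z :=
  Abelian.Ext.contravariant_sequence_exact₂ (shortExact_of_exact hf hg hfg) _ z hz

lemma exists_extPre_eq_smul (hf : Function.Injective f) (hg : Function.Surjective g)
    (hfg : Function.Exact f g) {n : ℕ} {r : R} (hr : ∀ y : ExtMod R C M (n + 1), r • y = 0)
    (z : ExtMod R A M n) : ∃ w, extPre f M n w = r • z :=
  Abelian.Ext.contravariant_sequence_exact₁ (shortExact_of_exact hf hg hfg) _ (r • z)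
    (add_comm 1 n) (by rw [Abelian.Ext.comp_smul]; exact hr _)

lemma smul_eq_zero_of_extPre_eq_zero (hf : Function.Injective f) (hg : Function.Surjective g)
    (hfg : Function.Exact f g) {n : ℕ} {r : R} (hr : ∀ y : ExtMod R A M n, r • y = 0)
    (z : ExtMod R C M (n + 1)) (hz : extPre g M (n + 1) z = 0) : r • z = 0 := by
  obtain ⟨y, rfl⟩ := Abelian.Ext.contravariant_sequence_exact₃ (shortExact_of_exact hf hg hfg)
    _ z hz (add_comm 1 n)
  rw [← Abelian.Ext.comp_smul]
  erw [hr y]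
  simp

lemma eq_zero_of_extPre_eq_zero (hg : Function.Surjective g)
    (z : ExtMod R C M 0) (hz : extPre g M 0 z = 0) : z = 0 := by
  obtain ⟨φ, rfl⟩ := (Abelian.Ext.mk₀_bijective _ _).2 z
  have : Epi (ModuleCat.ofHom g) := (ModuleCat.epi_iff_surjective _).2 hg
  simp only [extPre, LinearMap.coe_mk, AddHom.coe_mk, Abelian.Ext.mk₀_comp_mk₀,
    Abelian.Ext.mk₀_eq_zero_iff] at hz ⊢
  exact Limits.zero_of_epi_comp _ hz

lemma smul_smul_eq_zero_of_exact (hf : Function.Injective f) (hg : Function.Surjective g)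
    (hfg : Function.Exact f g) {n : ℕ} {r s : R} (hr : ∀ y : ExtMod R X A (n + 1), r • y = 0)
    (hs : ∀ y : ExtMod R X B n, s • y = 0) (z : ExtMod R X C n) : s • r • z = 0 := by
  obtain ⟨w, hw⟩ := Abelian.Ext.covariant_sequence_exact₃ _ (shortExact_of_exact hf hg hfg)
    (r • z) rfl (by rw [Abelian.Ext.smul_comp]; exact hr _)
  rw [← hw, ← Abelian.Ext.smul_comp]
  erw [hs w]
  simp

end exact
end

section
variable {R : Type} [CommRing R] {L M : Type}
  [AddCommGroup L] [Module R L] [AddCommGroup M] [Module R M]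

/-- The map `R/I^s → L` sending `1` to an element `l` killed by `I^s`. -/
def quotToMap (I : Ideal R) (s : ℕ) (l : L) (h : ∀ a ∈ I ^ s, a • l = 0) : (R ⧸ I ^ s) →ₗ[R] L :=
  Submodule.liftQ (I ^ s) (LinearMap.toSpanSingleton R L l) (fun a ha ↦ by simpa using h a ha)

lemma quotToMap_comp_mapQ (I : Ideal R) {s t : ℕ} (hst : t ≤ s) (l : L)
    (h : ∀ a ∈ I ^ t, a • l = 0) :
    quotToMap I t l h ∘ₗ Submodule.mapQ _ _ LinearMap.id (Ideal.pow_le_pow_right hst) =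
      quotToMap I s l (fun a ha ↦ h a (Ideal.pow_le_pow_right hst ha)) := by
  apply Submodule.linearMap_qext
  ext
  simp only [quotToMap, LinearMap.comp_apply, Submodule.mapQ_apply, Submodule.mkQ_apply,
    Submodule.liftQ_apply, LinearMap.id_apply]

lemma exists_extPre_smul_eq_zero (I : Ideal R) {n : ℕ} {x : R}
    (hx : ∀ y : H R I n M, x • y = 0) {t : ℕ} (z : ExtMod R (R ⧸ I ^ t) M n) :
    ∃ (s₀ : ℕ) (_ : t ≤ s₀), ∀ (s : ℕ) (_ : s₀ ≤ s) (h : t ≤ s),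
      extPre (Submodule.mapQ _ _ LinearMap.id (Ideal.pow_le_pow_right h)) M n (x • z) = 0 := by
  obtain ⟨s, h, hs⟩ := exists_comp_eq_zero_of_localCohomology I n (ModuleCat.of R M) x hx t z
  refine ⟨s, h, fun s' h' h'' ↦ ?_⟩
  change extPre (Submodule.mapQ _ _ LinearMap.id (Ideal.pow_le_pow_right h)) M n (x • z) = 0 at hs
  have : (Submodule.mapQ (I ^ s') (I ^ t) LinearMap.id (Ideal.pow_le_pow_right h'')) =
      (Submodule.mapQ (I ^ s) (I ^ t) LinearMap.id (Ideal.pow_le_pow_right h)) ∘ₗ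
      (Submodule.mapQ (I ^ s') (I ^ s) LinearMap.id (Ideal.pow_le_pow_right h')) := by
    apply Submodule.linearMap_qext
    ext
    simp
  rw [this, ← extPre_extPre, hs, map_zero]

/-- If `x` kills the local cohomology of `M` in degrees up to `n`, then `x ^ (n + 1)` kills
`Ext^n(L, M)` for all finitely generated `L` killed by a power of `I`. -/
theorem pow_smul_ext_eq_zero_of_torsion [IsNoetherianRing R] (I : Ideal R) (x : R) (n : ℕ)
    (hx : ∀ i ≤ n, ∀ y : H R I i M, x • y = 0) (L : Type) [AddCommGroup L] [Module R L]
    [Module.Finite R L] (t : ℕ) (ht : ∀ a ∈ I ^ t, ∀ l : L, a • l = 0) (z : ExtMod R L M n) :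
    x ^ (n + 1) • z = 0 := by
  induction n using Nat.strong_induction_on generalizing L t with
  | _ n ih =>
  obtain ⟨k, v, hv⟩ := Module.Finite.exists_fin (R := R) (M := L)
  choose s hts hs using fun j ↦ exists_extPre_smul_eq_zero I (hx n le_rfl)
    (extPre (quotToMap I t (v j) fun a ha ↦ ht a ha _) M n z)
  let s' := t + ∑ j, s j
  have h1 : t ≤ s' := Nat.le_add_right _ _
  have h2 : ∀ j, s j ≤ s' := fun j ↦
    (Finset.single_le_sum (fun _ _ ↦ Nat.zero_le _) (Finset.mem_univ j)).trans
      (Nat.le_add_left _ _)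
  have ht' : ∀ a ∈ I ^ s', ∀ l : L, a • l = 0 := fun a ha ↦ ht a (Ideal.pow_le_pow_right h1 ha)
  let g : (Fin k → R ⧸ I ^ s') →ₗ[R] L :=
    LinearMap.lsum R (fun _ ↦ R ⧸ I ^ s') R (fun j ↦ quotToMap I s' (v j) fun a ha ↦ ht' a ha _)
  have hgs : ∀ j, g ∘ₗ LinearMap.single R (fun _ ↦ R ⧸ I ^ s') j =
      quotToMap I s' (v j) fun a ha ↦ ht' a ha _ := fun j ↦ by
    ext
    simp only [g, LinearMap.comp_apply, LinearMap.lsum_apply, LinearMap.sum_apply,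
      LinearMap.coe_single, LinearMap.proj_apply]
    rw [Finset.sum_eq_single j (fun i _ hi ↦ by simp [Pi.single_eq_of_ne hi]) (by simp)]
    simp
  have hg : Function.Surjective g := by
    rw [← LinearMap.range_eq_top, ← top_le_iff, ← hv, Submodule.span_le]
    rintro _ ⟨j, rfl⟩
    refine ⟨Pi.single j (Submodule.Quotient.mk 1), ?_⟩
    exact (LinearMap.congr_fun (hgs j) (Submodule.Quotient.mk 1)).trans (one_smul R (v j))
  have hz : extPre g M n (x • z) = 0 := by
    apply eq_zero_of_extPre_single
    intro j
    rw [extPre_extPre, hgs, ← quotToMap_comp_mapQ I h1 (v j) (fun a ha ↦ ht a ha _),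
      ← extPre_extPre, map_smul]
    exact hs j s' (h2 j) h1
  obtain _ | n := n
  · simpa using eq_zero_of_extPre_eq_zero hg _ hz
  · rw [pow_succ, mul_smul]
    refine smul_eq_zero_of_extPre_eq_zero (Submodule.subtype_injective _) hg
      (LinearMap.exact_subtype_ker_map g) (fun y ↦ ?_) _ hz
    refine ih n (Nat.lt_succ_self n) (fun i hi ↦ hx i (hi.trans n.le_succ)) _ s' (fun a ha l ↦ ?_) y
    ext j
    obtain ⟨b, hb⟩ := Submodule.Quotient.mk_surjective _ ((l : Fin k → R ⧸ I ^ s') j)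
    simp only [Submodule.coe_smul, Pi.smul_apply, ← hb, ← Submodule.Quotient.mk_smul]
    exact (Submodule.Quotient.mk_eq_zero _).2 (Ideal.mul_mem_right _ _ ha)

end

section
open Module IsLocalRing
open scoped Pointwise

lemma le_of_add_one_le_add_one {d : WithBot ℕ∞} {e : ℕ} (h : d + 1 ≤ (e + 1 : ℕ)) : d ≤ e := by
  push_cast at h
  exact ENat.WithBot.add_le_add_one_right_iff.1 h

section
variable {R : Type} [CommRing R] {N : Type} [AddCommGroup N] [Module R N] [Module.Finite R N]

lemma supportDim_quotient_range_le {e : ℕ} (hN : supportDim R N ≤ (e + 1 : ℕ)) {y : R}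
    (hy : ∀ q ∈ (annihilator R N).minimalPrimes, y ∉ q) :
    supportDim R (N ⧸ LinearMap.range (y • (LinearMap.id : N →ₗ[R] N))) ≤ e := by
  have e1 : LinearMap.range (y • (LinearMap.id : N →ₗ[R] N)) = y • (⊤ : Submodule R N) := by
    ext
    simp [Submodule.mem_smul_pointwise_iff_exists]
  rw [e1]
  exact le_of_add_one_le_add_one
    ((supportDim_quotSMulTop_succ_le_of_notMem_minimalPrimes hy).trans hN)

end

section
variable {R : Type} [CommRing R] [IsLocalRing R] {N : Type} [AddCommGroup N] [Module R N]

lemma supportDim_le_zero_of_support (h : support R N ⊆ {closedPoint R}) : supportDim R N ≤ 0 := by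
  have : Subsingleton (support R N) := ⟨fun a b ↦ Subtype.ext ((h a.2).trans (h b.2).symm)⟩
  exact Order.krullDim_nonpos_of_subsingleton

lemma support_subset_of_supportDim_le_zero (h : supportDim R N ≤ 0) :
    support R N ⊆ {closedPoint R} := by
  cases subsingleton_or_nontrivial N
  · simp [support_eq_empty]
  · have h0 : supportDim R N = 0 := le_antisymm h
      (have := (nonempty_support_of_nontrivial (R := R) (M := N)).to_subtype
       Order.krullDim_nonneg)
    rw [support_of_supportDim_eq_zero R N h0, PrimeSpectrum.zeroLocus_eq_singleton]
    rfl

lemma support_subset_of_mem_minimalPrimes [Module.Finite R N]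
    (h : maximalIdeal R ∈ (annihilator R N).minimalPrimes) :
    support R N ⊆ {closedPoint R} := by
  intro q hq
  rw [support_eq_zeroLocus] at hq
  exact PrimeSpectrum.ext (le_antisymm (le_maximalIdeal q.2.ne_top)
    (h.2 ⟨q.2, hq⟩ (le_maximalIdeal q.2.ne_top)))

end

variable {R : Type} [CommRing R] [IsNoetherianRing R] {N : Type} [AddCommGroup N] [Module R N]

/-- Prime avoidance for the minimal primes of an ideal. -/
lemma exists_mem_notMem_minimalPrimes (I p : Ideal R) [p.IsPrime] (h : I ≤ p)
    (hp : p ∉ I.minimalPrimes) : ∃ y ∈ p, ∀ q ∈ I.minimalPrimes, y ∉ q := by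
  by_contra! H
  have hs : (p : Set R) ⊆ ⋃ q ∈ I.minimalPrimes, (q : Set R) := fun y hy ↦ by
    obtain ⟨q, hq, hyq⟩ := H y hy
    exact Set.mem_biUnion hq hyq
  obtain ⟨q, hq, hpq⟩ := (Ideal.subset_union_prime_finite
    (I.finite_minimalPrimes_of_isNoetherianRing R) (f := id) ⊥ ⊥ fun i hi _ _ ↦ hi.1.1).1 hs
  exact hp (le_antisymm hpq (hq.2 ⟨‹_›, h⟩ hpq) ▸ hq)

variable [Module.Finite R N]

lemma supportDim_ker_le {e : ℕ} (hN : supportDim R N ≤ (e + 1 : ℕ)) {y : R}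
    (hy : ∀ q ∈ (annihilator R N).minimalPrimes, y ∉ q) :
    supportDim R (LinearMap.ker (y • (LinearMap.id : N →ₗ[R] N))) ≤ e := by
  refine le_trans ?_ (le_of_add_one_le_add_one
    ((supportDim_quotSMulTop_succ_le_of_notMem_minimalPrimes hy).trans hN))
  have hsub : support R (LinearMap.ker (y • (LinearMap.id : N →ₗ[R] N))) ⊆
      support R (QuotSMulTop y N) := by
    rw [support_quotSMulTop]
    refine Set.subset_inter (support_subset_of_injective _ (Submodule.subtype_injective _)) ?_
    refine support_eq_zeroLocus.le.trans (PrimeSpectrum.zeroLocus_anti_mono ?_)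
    rintro _ rfl
    exact mem_annihilator.2 fun n ↦ Subtype.ext (LinearMap.mem_ker.1 n.2)
  exact Order.krullDim_le_of_strictMono (fun a ↦ ⟨a.1, hsub a.2⟩) (fun {_ _} lt ↦ lt)

variable [IsLocalRing R]

lemma exists_pow_smul_eq_zero_of_support (h : support R N ⊆ {closedPoint R}) :
    ∃ t, ∀ a ∈ maximalIdeal R ^ t, ∀ n : N, a • n = 0 := by
  have hle : maximalIdeal R ≤ (annihilator R N).radical := by
    rw [Ideal.radical_eq_sInf]
    refine le_sInf fun q hq ↦ ?_
    have := @h ⟨q, hq.2⟩ (by rw [support_eq_zeroLocus]; exact hq.1)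
    rw [Set.mem_singleton_iff] at this
    exact (congrArg PrimeSpectrum.asIdeal this).ge
  obtain ⟨t, ht⟩ := Ideal.exists_pow_le_of_le_radical_of_fg hle (IsNoetherian.noetherian _)
  exact ⟨t, fun a ha n ↦ mem_annihilator.1 (ht ha) n⟩

end

section
open Module IsLocalRing
variable {R : Type} [CommRing R]

/-- A power of `x` kills `Ext^i(L, M)` for all `i < d` and all finitely generated modules `L`
killed by a power of the maximal ideal. -/
def KillsTorsionExt [IsLocalRing R] (x : R) (M : Type) [AddCommGroup M] [Module R M] (d : ℕ) :
    Prop :=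
  ∃ k : ℕ, ∀ i < d, ∀ (L : Type) [AddCommGroup L] [Module R L] [Module.Finite R L] (t : ℕ),
    (∀ a ∈ maximalIdeal R ^ t, ∀ l : L, a • l = 0) → ∀ z : ExtMod R L M i, x ^ k • z = 0

lemma killsTorsionExt_of_localCohomology [IsNoetherianRing R] [IsLocalRing R] {x : R} {M : Type}
    [AddCommGroup M] [Module R M] {d : ℕ}
    (h : ∀ i < d, ∀ y : H R (maximalIdeal R) i M, x • y = 0) : KillsTorsionExt x M d := by
  refine ⟨d, fun i hi L _ _ _ t ht z ↦ ?_⟩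
  obtain ⟨c, rfl⟩ := Nat.exists_eq_add_of_lt hi
  have := pow_smul_ext_eq_zero_of_torsion (maximalIdeal R) x i (fun j hj ↦ h j (by omega)) L t ht z
  rw [show i + c + 1 = c + (i + 1) by ring, pow_add, mul_smul, this, smul_zero]

variable {N M : Type} [AddCommGroup N] [Module R N] [AddCommGroup M] [Module R M]

/-- If `r` kills `Ext^n(0 :_N y, M)` and `s` kills `Ext^(n+1)(N / yN, M)`, then `s * r` maps
`Ext^n(N, M)` into its submodule of multiples of `y`. -/
lemma exists_smul_eq_smul_smul (y : R) {n : ℕ} {r s : R}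
    (hr : ∀ z : ExtMod R (LinearMap.ker (y • (LinearMap.id : N →ₗ[R] N))) M n, r • z = 0)
    (hs : ∀ z : ExtMod R (N ⧸ LinearMap.range (y • (LinearMap.id : N →ₗ[R] N))) M (n + 1),
      s • z = 0) (z : ExtMod R N M n) : ∃ v, y • v = s • r • z := by
  set μ := y • (LinearMap.id : N →ₗ[R] N)
  have hex : Function.Exact (LinearMap.ker μ).subtype μ.rangeRestrict :=
    fun a ↦ by simp [Subtype.ext_iff]
  obtain ⟨w, hw⟩ := exists_extPre_eq (Submodule.subtype_injective _) μ.surjective_rangeRestrict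
    hex (r • z) (by rw [map_smul]; exact hr _)
  obtain ⟨v, hv⟩ := exists_extPre_eq_smul (Submodule.subtype_injective _)
    (Submodule.mkQ_surjective (LinearMap.range μ)) (LinearMap.exact_subtype_mkQ _) hs w
  refine ⟨v, ?_⟩
  rw [← hw, ← map_smul, ← hv, extPre_extPre, ← extPre_smul_id]
  rfl

variable [IsNoetherianRing R] [IsLocalRing R] [Module.Finite R M]

/-- Dévissage from modules of finite length to modules of small dimension. -/
theorem exists_pow_smul_ext_eq_zero {x : R} {d : ℕ} (h : KillsTorsionExt x M d) (e : ℕ) :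
    ∃ k : ℕ, ∀ (N : Type) [AddCommGroup N] [Module R N] [Module.Finite R N],
      supportDim R N ≤ e → ∀ i, i + e < d → ∀ z : ExtMod R N M i, x ^ k • z = 0 := by
  induction e with
  | zero =>
    obtain ⟨k, hk⟩ := h
    refine ⟨k, fun N _ _ _ hN i hi z ↦ ?_⟩
    obtain ⟨t, ht⟩ := exists_pow_smul_eq_zero_of_support
      (support_subset_of_supportDim_le_zero (by simpa using hN))
    exact hk i hi N t ht z
  | succ e ih =>
    obtain ⟨k, hk⟩ := ih
    refine ⟨k + k, fun N _ _ _ hN i hi z ↦ ?_⟩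
    by_cases hN' : supportDim R N ≤ e
    · rw [pow_add, mul_smul, hk N hN' i (by omega) z, smul_zero]
    obtain ⟨y, hym, hy⟩ := exists_mem_notMem_minimalPrimes (annihilator R N) (maximalIdeal R)
      (by
        have : Nontrivial N := by
          rw [← supportDim_ne_bot_iff_nontrivial R]
          rintro h
          simp [h] at hN'
        exact le_maximalIdeal (annihilator_eq_top_iff.not.2 (not_subsingleton N)))
      (fun hm ↦ hN' ((supportDim_le_zero_of_support (support_subset_of_mem_minimalPrimes hm)).trans
        (by exact_mod_cast Nat.zero_le e)))
    suffices x ^ (k + k) • z ∈ (⨅ n : ℕ, maximalIdeal R ^ n • ⊤ : Submodule R (ExtMod R N M i)) by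
      rwa [Ideal.iInf_pow_smul_eq_bot_of_isLocalRing _ (Ideal.IsPrime.ne_top inferInstance)] at this
    refine Submodule.mem_iInf _ |>.2 fun n ↦ ?_
    have hyn : ∀ q ∈ (annihilator R N).minimalPrimes, y ^ n ∉ q := fun q hq hyq ↦
      hy q hq (hq.1.1.mem_of_pow_mem _ hyq)
    obtain ⟨v, hv⟩ := exists_smul_eq_smul_smul (y ^ n)
      (hk _ (supportDim_ker_le hN hyn) i (by omega))
      (hk _ (supportDim_quotient_range_le hN hyn) (i + 1) (by omega)) z
    rw [pow_add, mul_smul, ← hv]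
    exact Submodule.smul_mem_smul (Ideal.pow_mem_pow hym n) trivial

end

section
open Module IsLocalRing RingTheory.Sequence
open scoped Pointwise TensorProduct
variable {R : Type} [CommRing R] {x : R}
variable {M : Type} [AddCommGroup M] [Module R M]

lemma killsTorsionExt_quotSMulTop [IsLocalRing R] {d k : ℕ} {a : R}
    (h : KillsTorsionExt x M (d + 1))
    (hk : ∀ m : M, a • m = 0 → x ^ k • m = 0) : KillsTorsionExt x (QuotSMulTop a M) d := by
  obtain ⟨l, hl⟩ := h
  set μ := a • (LinearMap.id : M →ₗ[R] M) with hμ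
  have e1 : LinearMap.range μ = a • (⊤ : Submodule R M) := by
    ext
    simp [hμ, Submodule.mem_smul_pointwise_iff_exists]
  have hex : Function.Exact (LinearMap.ker μ).subtype μ.rangeRestrict :=
    fun m ↦ by simp [Subtype.ext_iff]
  suffices H : KillsTorsionExt x (M ⧸ LinearMap.range μ) d by rwa [e1] at H
  refine ⟨l + (l + k), fun i hi L _ _ _ t ht z ↦ ?_⟩
  rw [pow_add, mul_smul]
  refine smul_smul_eq_zero_of_exact (Submodule.subtype_injective _)
    (Submodule.mkQ_surjective (LinearMap.range μ)) (LinearMap.exact_subtype_mkQ _)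
    (fun y ↦ ?_) (fun y ↦ hl i (by omega) L t ht y) z
  rw [pow_add, mul_smul]
  refine smul_smul_eq_zero_of_exact (Submodule.subtype_injective _) μ.surjective_rangeRestrict hex
    (fun y ↦ smul_extMod_eq_zero_of_right _ (fun m ↦ ?_) y)
    (fun y ↦ hl (i + 1) (by omega) L t ht y) y
  exact Subtype.ext (hk m (LinearMap.mem_ker.1 m.2))

lemma isSMulRegular_of_isLocalizedModule {S : Submonoid R} (hx : x ∈ S) {M' : Type}
    [AddCommGroup M'] [Module R M'] (f : M →ₗ[R] M') [IsLocalizedModule S f] {k : ℕ} {a : R}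
    (hk : ∀ m : M, a • m = 0 → x ^ k • m = 0) : IsSMulRegular M' a := by
  rw [isSMulRegular_iff_right_eq_zero_of_smul]
  intro y hy
  obtain ⟨⟨m, s⟩, hm⟩ := IsLocalizedModule.surj S f y
  dsimp only at hm
  have h0 : f (a • m) = 0 := by
    rw [map_smul, ← hm, smul_comm, hy, smul_zero]
  obtain ⟨c, hc⟩ := (IsLocalizedModule.eq_zero_iff S f).1 h0
  have h1 : x ^ k • c • m = 0 := hk _ (by rw [smul_comm]; exact hc)
  have h2 : f m = 0 := (IsLocalizedModule.eq_zero_iff S f).2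
    ⟨⟨x ^ k, pow_mem hx k⟩ * c, by rw [mul_smul]; exact h1⟩
  refine IsLocalizedModule.smul_injective f s ?_
  simp only [hm, h2, smul_zero]

variable [IsNoetherianRing R] [IsLocalRing R]

lemma exists_pow_smul_eq_zero_of_smul_eq_zero [Module.Finite R M] {d : ℕ} {a : R}
    (h : KillsTorsionExt x M (d + 1)) (hM : supportDim R M ≤ (d + 1 : ℕ))
    (ha : ∀ q ∈ (annihilator R M).minimalPrimes, a ∉ q) :
    ∃ k, ∀ m : M, a • m = 0 → x ^ k • m = 0 := by
  obtain ⟨k, hk⟩ := exists_pow_smul_ext_eq_zero h d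
  refine ⟨k, fun m hm ↦ ?_⟩
  set C := LinearMap.ker (a • (LinearMap.id : M →ₗ[R] M)) with hC
  have := hk C (supportDim_ker_le hM ha) 0 (by omega)
    (Abelian.Ext.mk₀ (ModuleCat.ofHom C.subtype))
  rw [← Abelian.Ext.mk₀_smul, Abelian.Ext.mk₀_eq_zero_iff] at this
  exact LinearMap.congr_fun (congrArg ModuleCat.Hom.hom this) ⟨m, by simpa [hC] using hm⟩

theorem exists_isWeaklyRegular_tensor (p : Ideal R) [p.IsPrime] (hxp : x ∉ p) (d : ℕ) :
    ∀ (M : Type) [AddCommGroup M] [Module R M] [Module.Finite R M],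
      supportDim R M ≤ d → KillsTorsionExt x M d → annihilator R M ≤ p →
      ∃ rs : List R, (∀ r ∈ rs, r ∈ p) ∧ IsWeaklyRegular (Localization.AtPrime p ⊗[R] M) rs ∧
        p ∈ (annihilator R (M ⧸ (Ideal.ofList rs • ⊤ : Submodule R M))).minimalPrimes := by
  induction d with
  | zero =>
    intro M _ _ _ hM h hp
    have hs := support_subset_of_supportDim_le_zero (by simpa using hM)
    have hq : ∀ q : Ideal R, q.IsPrime → annihilator R M ≤ q → q = maximalIdeal R := fun q h1 h2 ↦
      congrArg PrimeSpectrum.asIdeal (@hs ⟨q, h1⟩ (by rw [support_eq_zeroLocus]; exact h2))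
    refine ⟨[], by simp, by simp, ?_⟩
    rw [(Submodule.quotEquivOfEqBot _ (by simp)).annihilator_eq]
    exact ⟨⟨‹_›, hp⟩, fun q hq' _ ↦ (hq p ‹_› hp).trans_le (hq q hq'.1 hq'.2).ge⟩
  | succ d ih =>
    intro M _ _ _ hM h hp
    by_cases hmin : p ∈ (annihilator R M).minimalPrimes
    · refine ⟨[], by simp, by simp, ?_⟩
      rwa [(Submodule.quotEquivOfEqBot _ (by simp)).annihilator_eq]
    obtain ⟨a, hap, ha⟩ := exists_mem_notMem_minimalPrimes _ p hp hmin
    obtain ⟨k, hk⟩ := exists_pow_smul_eq_zero_of_smul_eq_zero h hM ha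
    have hann : annihilator R (QuotSMulTop a M) ≤ p := by
      have : (⟨p, ‹_›⟩ : PrimeSpectrum R) ∈ support R (QuotSMulTop a M) := by
        rw [support_quotSMulTop, support_eq_zeroLocus]
        exact ⟨hp, by simpa using hap⟩
      exact annihilator_le_of_mem_support this
    obtain ⟨rs, hrs, hreg, hrmin⟩ := ih (QuotSMulTop a M)
      (le_of_add_one_le_add_one
        ((supportDim_quotSMulTop_succ_le_of_notMem_minimalPrimes ha).trans hM))
      (killsTorsionExt_quotSMulTop h hk) hann
    refine ⟨a :: rs, by simpa using ⟨hap, hrs⟩, ?_, ?_⟩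
    · rw [isWeaklyRegular_cons_iff]
      exact ⟨isSMulRegular_of_isLocalizedModule (S := p.primeCompl) hxp
          (TensorProduct.mk R (Localization.AtPrime p) M 1) hk,
        ((QuotSMulTop.tensorQuotSMulTopEquivQuotSMulTop a _ M).isWeaklyRegular_congr rs).1 hreg⟩
    · rwa [(Submodule.quotOfListConsSMulTopEquivQuotSMulTopInner M a rs).annihilator_eq]

end

section
open Module IsLocalRing RingTheory.Sequence
variable {R : Type} [CommRing R] {M : Type} [AddCommGroup M] [Module R M]

lemma dimMod_eq_supportDim [Module.Finite R M] : dimMod R M = supportDim R M :=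
  Order.krullDim_eq_of_orderIso
    { toFun := fun p ↦ ⟨⟨p.1, p.2.1⟩, by rw [support_eq_zeroLocus]; exact p.2.2⟩
      invFun := fun p ↦ ⟨p.1.asIdeal, p.1.2, annihilator_le_of_mem_support p.2⟩
      left_inv := fun _ ↦ rfl
      right_inv := fun _ ↦ rfl
      map_rel_iff' := Iff.rfl }

lemma dimModAt_maximalIdeal [IsLocalRing R] : dimModAt R M (maximalIdeal R) = dimMod R M :=
  Order.krullDim_eq_of_orderIso
    { toFun := fun p ↦ ⟨p.1, p.2.1, p.2.2.1⟩
      invFun := fun p ↦ ⟨p.1, p.2.1, p.2.2, le_maximalIdeal p.2.1.ne_top⟩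
      left_inv := fun _ ↦ rfl
      right_inv := fun _ ↦ rfl
      map_rel_iff' := Iff.rfl }

lemma isCMLocalMod_of_isRegular [IsNoetherianRing R] [IsLocalRing R] [Module.Finite R M]
    (rs : List R)
    (hrs : ∀ r ∈ rs, r ∈ maximalIdeal R) (hreg : IsRegular M rs)
    (h : supportDim R (M ⧸ (Ideal.ofList rs • ⊤ : Submodule R M)) ≤ 0) : IsCMLocalMod R M := by
  have key : ∀ l : List R, IsRegular M l → (l.length : WithBot ℕ∞) ≤ supportDim R M := by
    intro l hl
    rw [← supportDim_add_length_eq_supportDim_of_isRegular l hl]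
    have := hl.quot_ofList_smul_nontrivial (⊤ : Submodule R M)
    have := (nonempty_support_of_nontrivial (R := R)
      (M := M ⧸ (Ideal.ofList l • ⊤ : Submodule R M))).to_subtype
    exact le_add_of_nonneg_left Order.krullDim_nonneg
  have hdim : supportDim R M = ((rs.length : ℕ∞) : WithBot ℕ∞) := by
    refine le_antisymm ?_ (key rs hreg)
    rw [← supportDim_add_length_eq_supportDim_of_isRegular rs hreg]
    exact (add_le_add_left h _).trans (zero_add _).le
  rw [IsCMLocalMod, dimMod_eq_supportDim, hdim, WithBot.coe_inj]
  refine le_antisymm (iSup₂_le fun l hl ↦ ?_) (le_iSup₂_of_le rs ⟨hrs, hreg⟩ le_rfl)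
  have := hdim ▸ key l hl.2
  exact WithBot.coe_le_coe.1 this

/-- If `p` is minimal over the annihilator of `M / (rs) M`, then the quotient of `M_p` by the
images of `rs` is supported at the closed point. -/
lemma support_quotient_localizedModule_subset (p : Ideal R) [p.IsPrime] (rs : List R)
    (hmin : p ∈ (annihilator R (M ⧸ (Ideal.ofList rs • ⊤ : Submodule R M))).minimalPrimes) :
    support (Localization.AtPrime p) (LocalizedModule p.primeCompl M ⧸
      (Ideal.ofList (rs.map (algebraMap R (Localization.AtPrime p))) • ⊤ :
        Submodule (Localization.AtPrime p) (LocalizedModule p.primeCompl M))) ⊆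
      {closedPoint (Localization.AtPrime p)} := by
  intro q hq
  set I := Ideal.ofList rs
  rw [← Ideal.map_ofList] at hq
  have hann := annihilator_le_of_mem_support hq
  have hle : annihilator R (M ⧸ (I • ⊤ : Submodule R M)) ≤
      q.asIdeal.comap (algebraMap R (Localization.AtPrime p)) := by
    intro a ha
    refine hann (mem_annihilator.2 fun y ↦ ?_)
    obtain ⟨y, rfl⟩ := Submodule.Quotient.mk_surjective _ y
    rw [← Submodule.Quotient.mk_smul, Submodule.Quotient.mk_eq_zero]
    induction y with | h m s
    have hm : a • m ∈ (I • ⊤ : Submodule R M) := by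
      have := mem_annihilator.1 ha (Submodule.Quotient.mk m)
      rwa [← Submodule.Quotient.mk_smul, Submodule.Quotient.mk_eq_zero] at this
    have hloc : ∀ m ∈ (I • ⊤ : Submodule R M), LocalizedModule.mk m s ∈
        (I.map (algebraMap R (Localization.AtPrime p)) • ⊤ :
          Submodule (Localization.AtPrime p) (LocalizedModule p.primeCompl M)) := by
      intro m hm
      refine Submodule.smul_induction_on hm (fun b hb n _ ↦ ?_) (fun m n hm hn ↦ ?_)
      · rw [← LocalizedModule.smul'_mk, ← algebraMap_smul (Localization.AtPrime p) b]
        exact Submodule.smul_mem_smul (Ideal.mem_map_of_mem _ hb) trivial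
      · rw [← LocalizedModule.mk_cancel_common_left s s (m + n), smul_add,
          ← LocalizedModule.mk_add_mk]
        exact add_mem hm hn
    rw [algebraMap_smul, LocalizedModule.smul'_mk]
    exact hloc _ hm
  have hqp : q.asIdeal.comap (algebraMap R (Localization.AtPrime p)) ≤ p :=
    fun r hr ↦ (IsLocalization.AtPrime.to_map_mem_maximal_iff (Localization.AtPrime p) p r).1
      (le_maximalIdeal q.2.ne_top hr)
  have hpq := hmin.2 ⟨inferInstance, hle⟩ hqp
  refine PrimeSpectrum.ext (le_antisymm (le_maximalIdeal q.2.ne_top) ?_)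
  refine (Localization.AtPrime.map_eq_maximalIdeal (I := p)).ge.trans ?_
  exact Ideal.map_le_iff_le_comap.2 hpq

end

end Paper

/-- If `x` is a uniform local cohomological annihilator of the finitely generated module
`M` over a Noetherian local ring, then `M_p` is Cohen–Macaulay for every prime
`p ∈ Supp M` with `x ∉ p`. -/
theorem localization_CM_of_isULCA (R : Type) [CommRing R] [IsNoetherianRing R]
    [IsLocalRing R] (M : Type) [AddCommGroup M] [Module R M] [Module.Finite R M]
    (x : R) (hx : Paper.IsULCA R M x) :
    ∀ (p : Ideal R) [p.IsPrime], p ∈ Paper.supp R M → x ∉ p →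
      Paper.IsCMLocalMod (Localization.AtPrime p) (LocalizedModule p.primeCompl M) := by
  intro p _ hp hxp
  have hpM : (⟨p, ‹_›⟩ : PrimeSpectrum R) ∈ Module.support R M := by
    rw [Module.support_eq_zeroLocus]
    exact hp.2
  have : Nontrivial M := Module.nonempty_support_iff.1 ⟨_, hpM⟩
  have : Nontrivial (LocalizedModule p.primeCompl M) := hpM
  obtain ⟨d, hd⟩ : ∃ d : ℕ, Module.supportDim R M = d := by
    have h1 := (Module.supportDim_le_ringKrullDim R M).trans_lt ringKrullDim_lt_top
    have h2 := Module.supportDim_ne_bot_of_nontrivial R M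
    lift Module.supportDim R M to ℕ∞ using h2 with c
    lift c to ℕ using (by rintro rfl; exact h1.ne rfl) with c
    exact ⟨c, rfl⟩
  have hkill : Paper.KillsTorsionExt x M d :=
    Paper.killsTorsionExt_of_localCohomology fun i hi ↦
      hx.2 (IsLocalRing.maximalIdeal R) inferInstance i <| by
        rw [Paper.dimModAt_maximalIdeal, Paper.dimMod_eq_supportDim, hd]
        exact_mod_cast hi
  obtain ⟨rs, hrs, hreg, hmin⟩ :=
    Paper.exists_isWeaklyRegular_tensor p hxp d M hd.le hkill hp.2
  rw [← ((LocalizedModule.equivTensorProduct p.primeCompl M).restrictScalars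
    R).isWeaklyRegular_congr rs,
    ← RingTheory.Sequence.isWeaklyRegular_map_algebraMap_iff (S := Localization.AtPrime p)] at hreg
  have hmem : ∀ r ∈ rs.map (algebraMap R (Localization.AtPrime p)),
      r ∈ IsLocalRing.maximalIdeal (Localization.AtPrime p) := by
    simp only [List.mem_map, forall_exists_index, and_imp, forall_apply_eq_imp_iff₂]
    intro r hr
    exact (IsLocalization.AtPrime.to_map_mem_maximal_iff (Localization.AtPrime p) p r).2 (hrs r hr)
  exact Paper.isCMLocalMod_of_isRegular _ hmem
    (RingTheory.Sequence.IsRegular.of_isWeaklyRegular_of_mem_maximalIdeal _ hmem hreg)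
    (Paper.supportDim_le_zero_of_support
      (Paper.support_quotient_localizedModule_subset p rs hmin))
end
end

section
/- Let M be a finitely generated module over a Noetherian ring R that has a uniform local cohomological annihilator. Then M is locally equidimensional: for every maximal ideal 𝔪 in Supp M, dim M_𝔪 = dim R_𝔪/𝔭R_𝔪 for every minimal prime 𝔭 of M contained in 𝔪. -/
noncomputable section
open CategoryTheory

section

open Opposite Limits

variable {R : Type} [CommRing R]

lemma oldExt_naturality {X X' : ModuleCat.{0} R} (g : X' ⟶ X)
    (P : ProjectiveResolution X) (P' : ProjectiveResolution X') (φ : P'.complex ⟶ P.complex)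
    (comm : φ.f 0 ≫ P.π.f 0 = P'.π.f 0 ≫ g) (n : ℕ) (Y : ModuleCat.{0} R) :
    ((Ext R (ModuleCat.{0} R) n).map g.op).app Y ≫ (P'.isoExt n Y).hom =
      (P.isoExt n Y).hom ≫ HomologicalComplex.homologyMap
        ((HomologicalComplex.unopFunctor _ _).map
          (((((linearYoneda R (ModuleCat.{0} R)).obj Y).rightOp.mapHomologicalComplex _).map φ).op)) n := by
  have h1 := P'.isoLeftDerivedObj_inv_naturality g P φ comm ((linearYoneda R (ModuleCat.{0} R)).obj Y).rightOp n
  have h1' := congrArg Quiver.Hom.unop h1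
  let Φ := ((HomologicalComplex.unopFunctor _ _).map
          (((((linearYoneda R (ModuleCat.{0} R)).obj Y).rightOp.mapHomologicalComplex _).map φ).op))
  have h2 := HomologicalComplex.homologyOp_hom_naturality Φ n
  have h3 := congrArg Quiver.Hom.unop (CommSq.horiz_inv (f := HomologicalComplex.homologyOp _ _) (i := HomologicalComplex.homologyOp _ _) ⟨h2.symm⟩).w
  simp only [unop_comp] at h1' h3
  have h1'' := congrArg (· ≫ ((P'.complex.linearYonedaObj R Y).homologyOp n).inv.unop) h1'
  refine Eq.trans (Category.assoc _ _ _).symm (Eq.trans h1'' ?_)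
  refine Eq.trans (Category.assoc _ _ _) (Eq.trans (congrArg (_ ≫ ·) h3) ?_)
  exact (Category.assoc _ _ _).symm

lemma exists_d_eq_of_liftCycles_homologyπ_eq_zero {K : CochainComplex (ModuleCat.{0} R) ℕ}
    {i j k : ℕ} (hi : (ComplexShape.up ℕ).prev j = i) (hk : (ComplexShape.up ℕ).next j = k)
    (x : ModuleCat.of R R ⟶ K.X j) (hx : x ≫ K.d j k = 0)
    (h : K.liftCycles x k hk hx ≫ K.homologyπ j = 0) :
    ∃ b : K.X i, (K.d i j).hom b = x.hom 1 := by
  obtain ⟨A', π, hπ, x₁, h₁⟩ :=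
    (K.liftCycles_comp_homologyπ_eq_zero_iff_up_to_refinements i j k hi hk x hx).1 h
  obtain ⟨a, ha⟩ := (ModuleCat.epi_iff_surjective π).1 hπ (1 : R)
  refine ⟨x₁.hom a, ?_⟩
  have := congrArg (fun f => f.hom a) h₁
  simp at this
  rw [← this]
  exact congrArg x.hom ha

lemma extMk_eq_zero_of_d_eq {X Y : ModuleCat.{0} R} (P : ProjectiveResolution X) (n : ℕ)
    (f : P.complex.X n ⟶ Y) (hf : P.complex.d (n + 1) n ≫ f = 0)
    (b : (P.complex.linearYonedaObj R Y).X ((ComplexShape.up ℕ).prev n))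
    (hb : (HomologicalComplex.d (P.complex.linearYonedaObj R Y)
      ((ComplexShape.up ℕ).prev n) n).hom b = f) :
    P.extMk f (n + 1) rfl hf = 0 := by
  cases n with
  | zero =>
    have : f = 0 := by
      rw [← hb, HomologicalComplex.shape]
      · rfl
      · simp
    subst this
    exact P.extMk_zero _ _
  | succ p =>
    rw [ProjectiveResolution.extMk_eq_zero_iff _ _ _ _ _ p rfl]
    have e : (ComplexShape.up ℕ).prev (p + 1) = p := by simp
    generalize (ComplexShape.up ℕ).prev (p + 1) = q at b hb e
    subst e
    exact ⟨b, hb⟩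

lemma exists_oldExt_of_ext (X Y : ModuleCat.{0} R) (n : ℕ) (α : Abelian.Ext X Y n) :
    ∃ β : ((Ext R (ModuleCat.{0} R) n).obj (op X)).obj Y,
      ∀ (X' : ModuleCat.{0} R) (g : X' ⟶ X) (r : R),
        r • (((Ext R (ModuleCat.{0} R) n).map g.op).app Y).hom β = 0 →
          r • (Abelian.Ext.mk₀ g).comp α (zero_add n) = 0 := by
  let P := projectiveResolution X
  obtain ⟨f, hf, rfl⟩ := P.extMk_surjective α (n + 1) rfl
  let K := P.complex.linearYonedaObj R Y
  let x : ModuleCat.of R R ⟶ K.X n := ModuleCat.ofHom (LinearMap.toSpanSingleton R _ f)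
  have hx : x ≫ K.d n (n + 1) = 0 := by
    ext
    change P.complex.d (n + 1) n ≫ ((1 : R) • f) = 0
    simp [hf]
  refine ⟨(P.isoExt n Y).inv.hom ((K.liftCycles x (n + 1) (by simp) hx ≫ K.homologyπ n).hom 1), ?_⟩
  intro X' g r h
  let P' := projectiveResolution X'
  let φ := ProjectiveResolution.lift g P' P
  have comm := ProjectiveResolution.lift_commutes_zero g P' P
  let φ' : P'.Hom P g := ⟨φ, by simpa using comm⟩
  have nat := oldExt_naturality g P P' φ comm n Y
  let Φ : K ⟶ P'.complex.linearYonedaObj R Y := ((HomologicalComplex.unopFunctor _ _).map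
          (((((linearYoneda R (ModuleCat.{0} R)).obj Y).rightOp.mapHomologicalComplex _).map φ).op))
  have h2 : r • (HomologicalComplex.homologyMap Φ n).hom
      ((K.liftCycles x (n + 1) (by simp) hx ≫ K.homologyπ n).hom 1) = 0 := by
    have e := congrArg (fun f => f.hom ((P.isoExt n Y).inv.hom
      ((K.liftCycles x (n + 1) (by simp) hx ≫ K.homologyπ n).hom 1))) nat
    have e' := congrArg (P'.isoExt n Y).hom.hom h
    rw [map_smul, map_zero] at e'
    refine Eq.trans (congrArg (r • ·) ?_) e'
    refine Eq.trans ?_ e.symm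
    refine congrArg (HomologicalComplex.homologyMap Φ n).hom ?_
    exact (congrArg (fun f => f.hom
      ((K.liftCycles x (n + 1) (by simp) hx ≫ K.homologyπ n).hom 1)) (P.isoExt n Y).inv_hom_id).symm
  have h3' : (x ≫ Φ.f n) ≫ (P'.complex.linearYonedaObj R Y).d n (n + 1) = 0 := by
    rw [Category.assoc, Φ.comm, reassoc_of% hx, zero_comp]
  have h3 : (r • (x ≫ Φ.f n)) ≫ (P'.complex.linearYonedaObj R Y).d n (n + 1) = 0 := by
    rw [Linear.smul_comp, h3', smul_zero]
  have h4 : (P'.complex.linearYonedaObj R Y).liftCycles (r • (x ≫ Φ.f n)) (n + 1) (by simp) h3 ≫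
      HomologicalComplex.homologyπ _ n = 0 := by
    have e1 : (P'.complex.linearYonedaObj R Y).liftCycles (r • (x ≫ Φ.f n)) (n + 1) (by simp) h3 =
        r • (K.liftCycles x (n + 1) (by simp) hx ≫ HomologicalComplex.cyclesMap Φ n) := by
      rw [← cancel_mono (HomologicalComplex.iCycles _ _)]
      simp
    rw [e1, Linear.smul_comp, Category.assoc, ← HomologicalComplex.homologyπ_naturality]
    ext
    exact h2
  have h5 : (x ≫ Φ.f n).hom 1 = φ.f n ≫ f := by
    change φ.f n ≫ ((1 : R) • f) = φ.f n ≫ f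
    rw [one_smul]
  obtain ⟨b, hb⟩ := exists_d_eq_of_liftCycles_homologyπ_eq_zero rfl (by simp) _ h3 h4
  rw [ProjectiveResolution.mk₀_comp_extMk (φ := φ')]
  have hc : P'.complex.d (n + 1) n ≫ (r • (φ.f n ≫ f)) = 0 := by
    rw [Linear.comp_smul, ← φ.comm_assoc, hf, comp_zero, smul_zero]
  have h6 : r • P'.extMk (φ'.hom.f n ≫ f) (n + 1) rfl (by rw [← φ'.hom.comm_assoc, hf, comp_zero]) =
      P'.extMk (r • (φ.f n ≫ f)) (n + 1) rfl hc := by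
    rw [Abelian.Ext.smul_eq_comp_mk₀, ProjectiveResolution.extMk_comp_mk₀]
    congr 1
  rw [h6]
  have hb' : (HomologicalComplex.d (P'.complex.linearYonedaObj R Y) ((ComplexShape.up ℕ).prev n) n).hom b
     = r • (φ.f n ≫ f) := by
    rw [hb, ← h5]; rfl
  exact extMk_eq_zero_of_d_eq P' n _ hc b hb'

lemma exists_smul_mk₀_comp_eq_zero_of_localCohomology (I : Ideal R) (i : ℕ) (M : ModuleCat.{0} R)
    (x : R) (h : ∀ y : (localCohomology I i).obj M, x • y = 0) (t : ℕ)
    (z : Abelian.Ext (ModuleCat.of R (R ⧸ I ^ t)) M i) :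
    ∃ (t' : ℕ) (ht : t ≤ t'), x • (Abelian.Ext.mk₀
      (ModuleCat.ofHom (Submodule.factor (Ideal.pow_le_pow_right (I := I) ht)))).comp z
        (zero_add i) = 0 := by
  obtain ⟨β, hβ⟩ := exists_oldExt_of_ext _ M i z
  let F := localCohomology.diagram (localCohomology.idealPowersDiagram I) i
  let D : Cocone (F ⋙ (evaluation _ _).obj M) :=
    ((evaluation _ _).obj M).mapCocone (colimit.cocone F)
  have hD : IsColimit D := isColimitOfPreserves _ (colimit.isColimit F)
  let β' : (F ⋙ (evaluation _ _).obj M).obj (op (op t)) := β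
  have hy : x • (D.ι.app (op (op t))).hom β' = 0 := h ((D.ι.app (op (op t))).hom β')
  rw [← map_smul, ← map_zero (D.ι.app (op (op t))).hom] at hy
  obtain ⟨k, f, g, hfg⟩ := Concrete.isColimit_exists_of_rep_eq _ hD _ _ hy
  have hfg' : ((F ⋙ (evaluation _ _).obj M).map f).hom (x • β') =
    ((F ⋙ (evaluation _ _).obj M).map g).hom 0 := hfg
  rw [map_smul, map_zero] at hfg'
  exact ⟨k.unop.unop, f.unop.unop.le, hβ _ _ x hfg'⟩

/-- Pulling back extension classes along a morphism, as a linear map. -/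
abbrev extPullback {N N' : ModuleCat.{0} R} (g : N' ⟶ N) (M : ModuleCat.{0} R) (i : ℕ) :
    Abelian.Ext N M i →ₗ[R] Abelian.Ext N' M i :=
  (Abelian.Ext.mk₀ g).precompOfLinear R M (zero_add i)

lemma extPullback_comp {N N' N'' : ModuleCat.{0} R} (f : N'' ⟶ N') (g : N' ⟶ N)
    (M : ModuleCat.{0} R) (i : ℕ) (z : Abelian.Ext N M i) :
    extPullback (f ≫ g) M i z = extPullback f M i (extPullback g M i z) := by
  simp [extPullback]

lemma extPullback_sum {N N' : ModuleCat.{0} R} {ι : Type*} [Fintype ι] (f : ι → (N' ⟶ N))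
    (M : ModuleCat.{0} R) (i : ℕ) (z : Abelian.Ext N M i) :
    extPullback (∑ j, f j) M i z = ∑ j, extPullback (f j) M i z := by
  simp [extPullback, Abelian.Ext.mk₀_sum]

lemma exists_surjective_smul_extPullback_eq_zero (I : Ideal R) (M : ModuleCat.{0} R) (x : R) (i : ℕ)
    (h : ∀ (t : ℕ) (z : Abelian.Ext (ModuleCat.of R (R ⧸ I ^ t)) M i),
      ∃ (t' : ℕ) (ht : t ≤ t'), x • extPullback
        (ModuleCat.ofHom (Submodule.factor (Ideal.pow_le_pow_right (I := I) ht))) M i z = 0)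
    (N : ModuleCat.{0} R) [Module.Finite R N] (n : ℕ) (hn : I ^ n ≤ Module.annihilator R N)
    (z : Abelian.Ext N M i) :
    ∃ (F : ModuleCat.{0} R) (_ : Module.Finite R F) (t : ℕ) (_ : I ^ t ≤ Module.annihilator R F)
      (π : F →ₗ[R] N), Function.Surjective π ∧ x • extPullback (ModuleCat.ofHom π) M i z = 0 := by
  obtain ⟨r, s, hs⟩ := Module.Finite.exists_fin (R := R) (M := N)
  let l (j : Fin r) : (R ⧸ I ^ n) →ₗ[R] N := Submodule.liftQ (I ^ n)
    (LinearMap.toSpanSingleton R N (s j))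
    (fun a ha => Module.mem_annihilator.1 (hn ha) (s j))
  choose t ht hz using fun j => h n (extPullback (ModuleCat.ofHom (l j)) M i z)
  let T := n + ∑ j, t j
  have htT (j) : t j ≤ T := le_add_left (Finset.single_le_sum (f := t) (fun _ _ => Nat.zero_le _)
    (Finset.mem_univ j))
  let g (j : Fin r) : (R ⧸ I ^ T) →ₗ[R] (R ⧸ I ^ t j) :=
    Submodule.factor (Ideal.pow_le_pow_right (htT j))
  let g' (j : Fin r) : (R ⧸ I ^ t j) →ₗ[R] (R ⧸ I ^ n) :=
    Submodule.factor (Ideal.pow_le_pow_right (ht j))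
  let π : (Fin r → R ⧸ I ^ T) →ₗ[R] N := ∑ j, l j ∘ₗ g' j ∘ₗ g j ∘ₗ LinearMap.proj j
  refine ⟨ModuleCat.of R (Fin r → R ⧸ I ^ T), inferInstanceAs (Module.Finite R (Fin r → R ⧸ I ^ T)),
    T, ?_, π, ?_, ?_⟩
  · intro a ha
    rw [Module.mem_annihilator]
    intro v
    funext j
    obtain ⟨b, hb⟩ := Ideal.Quotient.mk_surjective (v j)
    change a • v j = 0
    rw [← hb, ← Ideal.Quotient.mk_eq_mk, ← Submodule.Quotient.mk_smul, Submodule.Quotient.mk_eq_zero]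
    exact Ideal.mul_mem_right _ _ ha
  · intro y
    obtain ⟨c, hc⟩ := (Submodule.mem_span_range_iff_exists_fun R).1 (hs ▸ Submodule.mem_top (x := y))
    refine ⟨fun j => Submodule.Quotient.mk (c j), ?_⟩
    rw [← hc]
    simp only [π, LinearMap.sum_apply]
    rfl
  · have : ModuleCat.ofHom π = ∑ j, ModuleCat.ofHom (g j ∘ₗ LinearMap.proj j) ≫
        ModuleCat.ofHom (g' j) ≫ ModuleCat.ofHom (l j) := by
      ext v
      simp [π, ModuleCat.hom_sum]
    rw [this, extPullback_sum, Finset.smul_sum]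
    refine Finset.sum_eq_zero fun j _ => ?_
    rw [extPullback_comp, extPullback_comp, ← map_smul, hz, map_zero]

lemma pow_smul_ext_eq_zero [IsNoetherianRing R] (I : Ideal R) (M : ModuleCat.{0} R) (x : R) (e : ℕ)
    (h : ∀ i ≤ e, ∀ (t : ℕ) (z : Abelian.Ext (ModuleCat.of R (R ⧸ I ^ t)) M i),
      ∃ (t' : ℕ) (ht : t ≤ t'), x • extPullback
        (ModuleCat.ofHom (Submodule.factor (Ideal.pow_le_pow_right (I := I) ht))) M i z = 0)
    (i : ℕ) (hi : i ≤ e)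
    (N : ModuleCat.{0} R) [Module.Finite R N] (n : ℕ) (hn : I ^ n ≤ Module.annihilator R N)
    (z : Abelian.Ext N M i) : x ^ (i + 1) • z = 0 := by
  induction i generalizing N n with
  | zero =>
    obtain ⟨F, _, t, ht, π, hπ, hz⟩ :=
      exists_surjective_smul_extPullback_eq_zero I M x 0 (h 0 hi) N n hn z
    have : Epi (ModuleCat.ofHom π) := (ModuleCat.epi_iff_surjective _).2 hπ
    refine Abelian.Ext.precomp_mk₀_injective_of_epi M (ModuleCat.ofHom π) ?_
    rw [map_zero, zero_add, pow_one]
    change extPullback (ModuleCat.ofHom π) M 0 (x • z) = 0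
    rwa [map_smul]
  | succ i ih =>
    obtain ⟨F, _, t, ht, π, hπ, hz⟩ :=
      exists_surjective_smul_extPullback_eq_zero I M x (i + 1) (h (i + 1) hi) N n hn z
    have hS := LinearMap.shortExact_shortComplexKer hπ
    rw [← map_smul] at hz
    obtain ⟨w, hw⟩ := Abelian.Ext.contravariant_sequence_exact₃ hS M (x • z) hz (add_comm 1 i)
    have hw0 := ih (by lia) (ModuleCat.of R (LinearMap.ker π)) t (ht.trans
      (LinearMap.annihilator_le_of_injective _ (LinearMap.ker π).subtype_injective)) w
    rw [pow_succ, mul_smul, ← hw, ← Abelian.Ext.comp_smul]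
    refine (congrArg (fun w => hS.extClass.comp w (add_comm 1 i)) hw0).trans ?_
    simp

lemma exists_notMem_smul_eq_zero_of_finite (p : Ideal R) [p.IsPrime] (N : Type) [AddCommGroup N]
    [Module R N] [Module.Finite R N] (h : ∀ v : N, ∃ s ∉ p, s • v = 0) :
    ∃ s ∉ p, ∀ v : N, s • v = 0 := by
  have h1 := (Module.notMem_support_iff' (p := ⟨p, inferInstance⟩)).2 h
  rw [Module.mem_support_iff_of_finite] at h1
  obtain ⟨s, hs, hs'⟩ := SetLike.not_le_iff_exists.1 h1
  exact ⟨s, hs', fun v => Module.mem_annihilator.1 hs v⟩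

/-- A power of `p` kills `N` locally at `p`. -/
def IsKilledNear (p : Ideal R) (N : Type) [AddCommGroup N] [Module R N] : Prop :=
  ∃ s ∉ p, ∃ n : ℕ, ∀ a ∈ p ^ n, ∀ v : N, s • a • v = 0

/-- Up to degree `k`, the element `y` kills, locally at `p`, the extensions by `M` of modules
which are locally killed by a power of `p`. -/
def ExtKilledNear (p : Ideal R) (M : ModuleCat.{0} R) (y : R) (k : ℕ) : Prop :=
  ∀ (N : ModuleCat.{0} R) [Module.Finite R N], IsKilledNear p N →
    ∀ i ≤ k, ∀ z : Abelian.Ext N M i, ∃ s ∉ p, s • y • z = 0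

lemma mk₀_smul_id_comp {N M : ModuleCat.{0} R} {i : ℕ} (z : Abelian.Ext N M i) (s : R) :
    (Abelian.Ext.mk₀ (s • 𝟙 N)).comp z (zero_add i) = s • z := by
  rw [Abelian.Ext.mk₀_smul, Abelian.Ext.smul_comp, Abelian.Ext.mk₀_id_comp]

lemma smul_ext_eq_zero {N M : ModuleCat.{0} R} {i : ℕ} (z : Abelian.Ext N M i) (s : R)
    (h : ∀ v : N, s • v = 0) : s • z = 0 := by
  have h1 : s • 𝟙 N = 0 := by
    ext v
    exact h v
  rw [← mk₀_smul_id_comp, h1, Abelian.Ext.mk₀_zero, Abelian.Ext.zero_comp]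

lemma extKilledNear_of_isSMulRegular [IsNoetherianRing R] (p : Ideal R) [hp : p.IsPrime]
    (M : ModuleCat.{0} R) (y : R) (k : ℕ)
    (h : ∀ (N : ModuleCat.{0} R) [Module.Finite R N] (n : ℕ), p ^ n ≤ Module.annihilator R N →
      (∀ s ∉ p, IsSMulRegular N s) → ∀ i ≤ k, ∀ z : Abelian.Ext N M i, ∃ s ∉ p, s • y • z = 0) :
    ExtKilledNear p M y k := by
  intro N _ hN i hi z
  obtain ⟨s, hs, n, hn⟩ := hN
  let T : Submodule R N :=
    { carrier := {v | ∃ s ∉ p, s • v = 0}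
      zero_mem' := ⟨1, hp.one_notMem, by simp⟩
      add_mem' := by
        rintro a b ⟨s, hs, ha⟩ ⟨t, ht, hb⟩
        refine ⟨s * t, hp.mul_notMem hs ht, ?_⟩
        rw [smul_add, mul_comm, mul_smul, ha, mul_comm, mul_smul, hb, smul_zero, smul_zero, add_zero]
      smul_mem' := by
        rintro c a ⟨s, hs, ha⟩
        exact ⟨s, hs, by rw [smul_comm, ha, smul_zero]⟩ }
  have hT := LinearMap.shortExact_shortComplexKer T.mkQ_surjective
  obtain ⟨t, ht, hkill⟩ := exists_notMem_smul_eq_zero_of_finite p (LinearMap.ker T.mkQ) (by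
    rintro ⟨v, hv⟩
    rw [Submodule.ker_mkQ] at hv
    obtain ⟨s, hs, h⟩ := hv
    exact ⟨s, hs, Subtype.ext h⟩)
  obtain ⟨z', hz'⟩ := Abelian.Ext.contravariant_sequence_exact₂ hT M (t • z) (by
    rw [Abelian.Ext.comp_smul]
    exact smul_ext_eq_zero _ _ hkill)
  obtain ⟨s', hs', h'⟩ := h (ModuleCat.of R (N ⧸ T)) n (by
      intro a ha
      rw [Module.mem_annihilator]
      intro v
      obtain ⟨v, rfl⟩ := T.mkQ_surjective v
      rw [← map_smul]
      exact (Submodule.Quotient.mk_eq_zero T).2 ⟨s, hs, hn a ha v⟩) (by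
      intro s hs
      refine (injective_iff_map_eq_zero (LinearMap.lsmul R (N ⧸ T) s)).2 ?_
      intro v hv
      obtain ⟨v, rfl⟩ := T.mkQ_surjective v
      rw [LinearMap.lsmul_apply, ← map_smul] at hv
      obtain ⟨u, hu, huv⟩ := (Submodule.Quotient.mk_eq_zero T).1 hv
      exact (Submodule.Quotient.mk_eq_zero T).2 ⟨u * s, hp.mul_notMem hu hs, by rwa [mul_smul]⟩)
      i hi z'
  refine ⟨s' * t, hp.mul_notMem hs' ht, ?_⟩
  rw [mul_smul, smul_comm t, ← hz', ← Abelian.Ext.comp_smul, ← Abelian.Ext.comp_smul]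
  refine (congrArg (fun w => (Abelian.Ext.mk₀ (T.mkQ.shortComplexKer).g).comp w (zero_add i)) h').trans ?_
  simp

lemma exists_notMem_mul_mem_of_mem_minimalPrimes [IsNoetherianRing R] (J q : Ideal R)
    (hq : q ∈ J.minimalPrimes) : ∃ s ∉ q, ∃ r : ℕ, ∀ a ∈ q ^ r, s * a ∈ J := by
  have hqp : q.IsPrime := hq.1.1
  have h1 := IsLocalization.AtPrime.radical_map_of_mem_minimalPrimes (Localization.AtPrime q) q J hq
  obtain ⟨r, hr⟩ := Ideal.exists_pow_le_of_le_radical_of_fg h1.ge (IsNoetherian.noetherian _)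
  rw [← Ideal.map_pow] at hr
  obtain ⟨s, hs, h⟩ := exists_notMem_smul_eq_zero_of_finite q
    ((q ^ r).map (Ideal.Quotient.mk J)) (by
      rintro ⟨v, hv⟩
      obtain ⟨a, ha, rfl⟩ := (Ideal.mem_map_iff_of_surjective _ Ideal.Quotient.mk_surjective).1 hv
      obtain ⟨s, hs, h⟩ := (IsLocalization.algebraMap_mem_map_algebraMap_iff q.primeCompl _ J a).1
        (hr (Ideal.mem_map_of_mem _ ha))
      refine ⟨s, hs, Subtype.ext ?_⟩
      exact Ideal.Quotient.eq_zero_iff_mem.2 h)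
  refine ⟨s, hs, r, fun a ha => ?_⟩
  exact Ideal.Quotient.eq_zero_iff_mem.1
    (congrArg Subtype.val (h ⟨_, Ideal.mem_map_of_mem (Ideal.Quotient.mk J) ha⟩))

lemma exists_notMem_smul_eq_zero_of_forall_pow [IsNoetherianRing R] (q : Ideal R) [hq : q.IsPrime]
    (E : Type) [AddCommGroup E] [Module R E] [Module.Finite R E] (w : R) (hw : w ∈ q) (v : E)
    (h : ∀ j : ℕ, ∃ s ∉ q, ∃ u : E, s • v = w ^ j • u) : ∃ s ∉ q, s • v = 0 := by
  let A := Localization.AtPrime q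
  let L := LocalizedModule q.primeCompl E
  let f := LocalizedModule.mkLinearMap q.primeCompl E
  have hI : q.map (algebraMap R A) ≠ ⊤ := by
    rw [Localization.AtPrime.map_eq_maximalIdeal]
    exact (IsLocalRing.maximalIdeal.isMaximal A).ne_top
  have hb := Ideal.iInf_pow_smul_eq_bot_of_isLocalRing (M := L) _ hI
  have hv : f v ∈ (⨅ i : ℕ, (q.map (algebraMap R A)) ^ i • ⊤ : Submodule A L) := by
    rw [Submodule.mem_iInf]
    intro j
    obtain ⟨s, hs, u, hu⟩ := h j
    have hs' : IsUnit (algebraMap R A s) := IsLocalization.map_units A (⟨s, hs⟩ : q.primeCompl)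
    rw [← Submodule.smul_mem_iff_of_isUnit _ hs', algebraMap_smul, ← map_smul, hu, map_smul,
      ← algebraMap_smul A (w ^ j) (f u), map_pow]
    exact Submodule.smul_mem_smul (Ideal.pow_mem_pow (Ideal.mem_map_of_mem _ hw) j) trivial
  rw [hb, Submodule.mem_bot] at hv
  obtain ⟨s, hs⟩ := (IsLocalizedModule.eq_zero_iff q.primeCompl f).1 hv
  exact ⟨s, s.2, hs⟩

lemma extKilledNear_of_forall_pow_smul_eq_zero [IsNoetherianRing R] (m : Ideal R) [m.IsPrime]
    (M : ModuleCat.{0} R) (x : R) (e : ℕ)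
    (h : ∀ i ≤ e, ∀ (N : ModuleCat.{0} R) [Module.Finite R N] (n : ℕ),
      m ^ n ≤ Module.annihilator R N → ∀ z : Abelian.Ext N M i, x ^ (i + 1) • z = 0) :
    ExtKilledNear m M (x ^ (e + 1)) e := by
  refine extKilledNear_of_isSMulRegular m M _ e fun N _ n hn _ i hi z => ⟨1, ?_, ?_⟩
  · exact Ideal.IsPrime.one_notMem inferInstance
  · rw [one_smul, show e + 1 = e - i + (i + 1) by lia, pow_add, mul_smul, h i hi N n hn, smul_zero]

open Pointwise in
lemma ExtKilledNear.of_lt [IsNoetherianRing R] {q q' : Ideal R} [hq : q.IsPrime] [hq' : q'.IsPrime]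
    (hlt : q < q') (hcov : ∀ P : Ideal R, P.IsPrime → q < P → P ≤ q' → P = q')
    (M : ModuleCat.{0} R) [Module.Finite R M] (y : R) (k : ℕ) (h : ExtKilledNear q' M y (k + 1)) :
    ExtKilledNear q M y k := by
  refine extKilledNear_of_isSMulRegular q M y k fun N _ n hn hreg i hi z => ?_
  obtain ⟨w, hw, hwq⟩ := SetLike.exists_of_lt hlt
  suffices ∃ s ∉ q', s • y • z = 0 by
    obtain ⟨s, hs, h⟩ := this
    exact ⟨s, fun h => hs (hlt.le h), h⟩
  refine exists_notMem_smul_eq_zero_of_forall_pow q' (Abelian.Ext N M i) w hw (y • z) fun j => ?_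
  rcases Nat.eq_zero_or_pos j with rfl | hj
  · exact ⟨1, hq'.one_notMem, y • z, by simp⟩
  replace hn := (Ideal.pow_le_pow_right n.le_succ).trans hn
  let z' : Abelian.Ext (ModuleCat.smulShortComplex N (w ^ j)).X₁ M i := z
  have hS := (hreg (w ^ j) (fun h => hwq (hq.mem_of_pow_mem j h))).smulShortComplex_shortExact
  have hmin : q' ∈ (q ^ (n + 1) ⊔ Ideal.span {w ^ j}).minimalPrimes := by
    refine ⟨⟨hq', ?_⟩, ?_⟩
    · refine sup_le ((Ideal.pow_le_self n.succ_ne_zero).trans hlt.le) ?_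
      exact (Ideal.span_singleton_le_iff_mem _).2 (Ideal.pow_mem_of_mem _ hw j hj)
    · rintro P ⟨hP, hP'⟩ hPq
      refine (hcov P hP (lt_of_le_of_ne ?_ ?_) hPq).ge
      · exact hP.le_of_pow_le (le_sup_left.trans hP')
      · rintro rfl
        exact hwq (hP.mem_of_pow_mem j (hP' (Ideal.mem_sup_right (Ideal.mem_span_singleton_self _))))
  obtain ⟨s, hs, r, hr⟩ := exists_notMem_mul_mem_of_mem_minimalPrimes _ _ hmin
  have hnear : IsKilledNear q' (ModuleCat.smulShortComplex N (w ^ j)).X₃ := by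
    refine ⟨s, hs, r, fun a ha v => ?_⟩
    obtain ⟨v, rfl⟩ := Submodule.mkQ_surjective _ v
    change s • a • Submodule.mkQ (w ^ j • (⊤ : Submodule R N)) v = 0
    rw [← mul_smul]
    obtain ⟨b, hb, c, hc, hbc⟩ := Submodule.mem_sup.1 (hr a ha)
    obtain ⟨d, rfl⟩ := Ideal.mem_span_singleton'.1 hc
    rw [← hbc, ← map_smul, add_smul, Module.mem_annihilator.1 (hn hb) v, zero_add, mul_comm,
      mul_smul]
    exact (Submodule.Quotient.mk_eq_zero _).2 (Submodule.smul_mem_pointwise_smul _ _ _ trivial)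
  have : Module.Finite R (ModuleCat.smulShortComplex N (w ^ j)).X₃ :=
    Module.Finite.of_surjective _ (Submodule.mkQ_surjective _)
  obtain ⟨s', hs', h'⟩ := h _ hnear (1 + i) (by lia) (hS.extClass.comp z' rfl)
  rw [← Abelian.Ext.comp_smul, ← Abelian.Ext.comp_smul] at h'
  obtain ⟨u, hu⟩ := Abelian.Ext.contravariant_sequence_exact₁ hS M _ _ h'
  refine ⟨s', hs', u, ?_⟩
  exact hu.symm.trans (mk₀_smul_id_comp u (w ^ j))

lemma ExtKilledNear.mem_of_mem_minimalPrimes [IsNoetherianRing R] {p : Ideal R}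
    {M : ModuleCat.{0} R} [Module.Finite R M] (hp : p ∈ (Module.annihilator R M).minimalPrimes)
    {y : R} (h : ExtKilledNear p M y 0) : y ∈ p := by
  have hpp : p.IsPrime := hp.1.1
  have hass := Module.associatedPrimes.minimalPrimes_annihilator_subset_associatedPrimes R M hp
  obtain ⟨_, v, hv⟩ := isAssociatedPrime_iff.1 hass
  have hv' (r : R) : r ∈ p ↔ r • v = 0 := by
    rw [hv, Submodule.mem_colon_singleton, Submodule.mem_bot]
  let f : (R ⧸ p) →ₗ[R] M := Submodule.liftQ p (LinearMap.toSpanSingleton R M v)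
    (fun a ha => (hv' a).1 ha)
  obtain ⟨s, hs, h0⟩ := h (ModuleCat.of R (R ⧸ p)) ⟨1, hpp.one_notMem, 1, fun a ha v => by
      obtain ⟨b, rfl⟩ := Ideal.Quotient.mk_surjective v
      rw [one_smul, ← Ideal.Quotient.mk_eq_mk, ← Submodule.Quotient.mk_smul,
        Submodule.Quotient.mk_eq_zero]
      exact Ideal.mul_mem_right _ _ (by simpa using ha)⟩ 0 le_rfl
    (Abelian.Ext.mk₀ (ModuleCat.ofHom f))
  rw [← Abelian.Ext.mk₀_smul, ← Abelian.Ext.mk₀_smul, Abelian.Ext.mk₀_eq_zero_iff] at h0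
  have h1 : s • y • v = 0 := by
    have := congrArg (fun g => g.hom (Submodule.Quotient.mk 1)) h0
    exact (congrArg (fun u => s • y • u) (one_smul R v)).symm.trans this
  rw [← mul_smul, ← hv'] at h1
  exact (hpp.mem_or_mem h1).resolve_left hs

lemma extKilledNear_of_coheight [IsNoetherianRing R] (p m : Ideal R) [hm : m.IsPrime]
    (M : ModuleCat.{0} R) [Module.Finite R M] (y : R) (e : ℕ) (h : ExtKilledNear m M y e)
    (c : ℕ) (hc : c ≤ e) (q : {q : Ideal R // q.IsPrime ∧ p ≤ q ∧ q ≤ m})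
    (hq : Order.coheight q = c) : ExtKilledNear q.1 M y (e - c) := by
  induction c generalizing q with
  | zero =>
    have hmax : IsMax q := by simpa using hq
    have hqm : q.1 = m := le_antisymm q.2.2.2
      (hmax (b := ⟨m, hm, q.2.2.1.trans q.2.2.2, le_rfl⟩) q.2.2.2)
    rw [hqm]
    exact h
  | succ c ih =>
    obtain ⟨hfin, ⟨q', hqq', hq'⟩, hle⟩ := Order.coheight_eq_coe_add_one_iff.1 (by simpa using hq)
    have := q.2.1
    have := q'.2.1
    refine ExtKilledNear.of_lt (q' := q'.1) hqq' ?_ M y _ ?_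
    · intro P hP hqP hPq'
      let P' : {q : Ideal R // q.IsPrime ∧ p ≤ q ∧ q ≤ m} :=
        ⟨P, hP, q.2.2.1.trans hqP.le, hPq'.trans q'.2.2.2⟩
      by_contra hne
      have h1 : P' < q' := lt_of_le_of_ne hPq' (fun h => hne (congrArg Subtype.val h))
      have h2 := Order.coheight_add_one_le h1
      have h3 := h2.trans (hle P' hqP)
      rw [hq'] at h3
      exact absurd h3 (by exact_mod_cast (by lia : ¬ c + 1 ≤ c))
    · rw [show e - (c + 1) + 1 = e - c by lia]
      exact ih (by lia) q' hq'

end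

/-- A finitely generated module with a uniform local cohomological annihilator over a
Noetherian ring is locally equidimensional: for every maximal ideal `m` of `Supp M` and
every minimal prime `p` of `M` with `p ≤ m`, one has `dim M_m = dim R_m / p R_m`. -/
theorem locally_equidim_of_hasULCA (R : Type) [CommRing R] [IsNoetherianRing R]
    (M : Type) [AddCommGroup M] [Module R M] [Module.Finite R M]
    (h : Paper.HasULCA R M) :
    ∀ (m : Ideal R), m.IsMaximal → m ∈ Paper.supp R M →
      ∀ p ∈ Paper.minSupp R M, p ≤ m →
        Order.krullDim {q : Ideal R // q.IsPrime ∧ p ≤ q ∧ q ≤ m} =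
          Paper.dimModAt R M m := by
  intro m hm _ p hp hpm
  obtain ⟨x, hx, hkill⟩ := h
  have hpp : p.IsPrime := hp.1.1
  let S := {q : Ideal R // q.IsPrime ∧ p ≤ q ∧ q ≤ m}
  let incl : S → {q : Ideal R // q.IsPrime ∧ Module.annihilator R M ≤ q ∧ q ≤ m} :=
    fun q => ⟨q.1, q.2.1, hp.1.2.trans q.2.2.1, q.2.2.2⟩
  refine le_antisymm (Order.krullDim_le_of_strictMono incl fun _ _ h => h) ?_
  by_contra! hlt
  change Order.krullDim S < _ at hlt
  let p₀ : S := ⟨p, hpp, le_rfl, hpm⟩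
  let _ : OrderBot S := { bot := p₀, bot_le := fun q => q.2.2.1 }
  have hdim : (Order.coheight p₀ : WithBot ℕ∞) = Order.krullDim S :=
    Order.coheight_bot_eq_krullDim
  rw [← hdim] at hlt
  have hfin : Order.coheight p₀ ≠ ⊤ := by
    intro h
    rw [h] at hlt
    exact not_top_lt hlt
  obtain ⟨e, he⟩ := ENat.ne_top_iff_exists.1 hfin
  rw [← he] at hlt
  have h1 := extKilledNear_of_forall_pow_smul_eq_zero m (ModuleCat.of R M) x e
    (pow_smul_ext_eq_zero m (ModuleCat.of R M) x e fun i hi =>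
      exists_smul_mk₀_comp_eq_zero_of_localCohomology m i (ModuleCat.of R M) x
        (hkill m hm i (lt_of_le_of_lt (by exact_mod_cast hi) hlt)))
  have h2 := extKilledNear_of_coheight p m (ModuleCat.of R M) _ e h1 e le_rfl p₀ he.symm
  rw [Nat.sub_self] at h2
  exact hx p hp (hpp.mem_of_pow_mem _ (h2.mem_of_mem_minimalPrimes hp))
end
end

section
/- Let M and N be finitely generated modules of finite Krull dimension over a Noetherian ring R with Supp M = Supp N. Then M has a uniform local cohomological annihilator if and only if N has a uniform local cohomological annihilator. -/
noncomputable section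
open CategoryTheory

namespace CategoryTheory.ProjectiveResolution

section

variable {R : Type*} [Ring R] {C : Type*} [Category* C] [Abelian C] [Linear R C]
  {X X' : C} (P : ProjectiveResolution X) (P' : ProjectiveResolution X')

/-- The morphism underlying a cocycle of the complex of morphisms out of a projective
resolution. -/
def cocycleHom (n : ℕ) (Y : C) :
    (P.complex.linearYonedaObj R Y).cycles n →ₗ[R] (P.complex.X n ⟶ Y) :=
  ((P.complex.linearYonedaObj R Y).iCycles n).hom

lemma d_comp_cocycleHom {n m : ℕ} (Y : C) (z : (P.complex.linearYonedaObj R Y).cycles n) :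
    P.complex.d m n ≫ P.cocycleHom n Y z = 0 := by
  have := ConcreteCategory.congr_hom ((P.complex.linearYonedaObj R Y).iCycles_d n m) z
  rw [ConcreteCategory.comp_apply] at this
  exact this

lemma exists_cocycleHom_eq {n : ℕ} (Y : C) (f : P.complex.X n ⟶ Y)
    (hf : P.complex.d (n + 1) n ≫ f = 0) :
    ∃ z, P.cocycleHom (R := R) n Y z = f := by
  set K := P.complex.linearYonedaObj R Y
  have hex := ShortComplex.exact_of_f_is_kernel (ShortComplex.mk _ _ (K.iCycles_d n (n + 1)))
    (K.cyclesIsKernel n (n + 1) (by simp))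
  rw [ShortComplex.moduleCat_exact_iff] at hex
  exact hex f hf

/-- The morphism of complexes of morphisms into `Y` induced by a morphism of projective
resolutions. -/
def linearYonedaObjMap (φ : P'.complex ⟶ P.complex) (Y : C) :
    P.complex.linearYonedaObj R Y ⟶ P'.complex.linearYonedaObj R Y :=
  (HomologicalComplex.unopFunctor _ _).map
    (((((linearYoneda R C).obj Y).rightOp.mapHomologicalComplex _).map φ).op)

lemma cocycleHom_cyclesMap (φ : P'.complex ⟶ P.complex) (n : ℕ) (Y : C)
    (z : (P.complex.linearYonedaObj R Y).cycles n) :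
    P'.cocycleHom n Y (HomologicalComplex.cyclesMap (linearYonedaObjMap P P' φ Y) n z) =
      φ.f n ≫ P.cocycleHom n Y z := by
  change ((P'.complex.linearYonedaObj R Y).iCycles n)
    (HomologicalComplex.cyclesMap (linearYonedaObjMap P P' φ Y) n z) = _
  rw [← ConcreteCategory.comp_apply, HomologicalComplex.cyclesMap_i]
  rfl

variable [EnoughProjectives C]

/-- The class in `Ext` of a cocycle of the complex of morphisms out of a projective resolution. -/
def extπ (n : ℕ) (Y : C) : (P.complex.linearYonedaObj R Y).cycles n ⟶
    ((Ext R C n).obj (Opposite.op X)).obj Y :=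
  (P.complex.linearYonedaObj R Y).homologyπ n ≫ (P.isoExt n Y).inv

lemma extπ_surjective (n : ℕ) (Y : C) : Function.Surjective (P.extπ (R := R) n Y) :=
  (ModuleCat.epi_iff_surjective _).1 (by unfold extπ; infer_instance)

lemma extπ_eq_zero_iff (n : ℕ) (Y : C) (z : (P.complex.linearYonedaObj R Y).cycles n) :
    P.extπ n Y z = 0 ↔ ∃ g : P.complex.X ((ComplexShape.up ℕ).prev n) ⟶ Y,
      P.complex.d n _ ≫ g = P.cocycleHom n Y z := by
  let K := P.complex.linearYonedaObj R Y
  have h : P.extπ n Y z = 0 ↔ K.homologyπ n z = 0 := by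
    unfold extπ
    have hinj : Function.Injective (P.isoExt (R := R) n Y).inv :=
      (ModuleCat.mono_iff_injective _).1 inferInstance
    rw [ConcreteCategory.comp_apply]
    exact map_eq_zero_iff _ hinj
  have hex := ShortComplex.exact_of_g_is_cokernel
    (ShortComplex.mk _ _ (K.toCycles_comp_homologyπ ((ComplexShape.up ℕ).prev n) n))
    (K.homologyIsCokernel _ n rfl)
  rw [ShortComplex.moduleCat_exact_iff] at hex
  have hi : Function.Injective (K.iCycles n) := (ModuleCat.mono_iff_injective _).1 inferInstance
  have htc (g : K.X ((ComplexShape.up ℕ).prev n)) :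
      K.iCycles n (K.toCycles _ n g) = K.d _ n g := by
    rw [← ConcreteCategory.comp_apply, K.toCycles_i]
  refine h.trans ⟨fun hz => ?_, ?_⟩
  · obtain ⟨g, hg⟩ := hex z hz
    exact ⟨g, (htc g).symm.trans (congrArg (K.iCycles n) hg)⟩
  · rintro ⟨g, hg⟩
    have hgz : K.toCycles ((ComplexShape.up ℕ).prev n) n g = z := hi ((htc g).trans hg)
    rw [← hgz]
    exact ConcreteCategory.congr_hom (K.toCycles_comp_homologyπ _ n) g

lemma extπ_naturality (g : X' ⟶ X) (φ : Hom P' P g) (n : ℕ) (Y : C) :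
    P.extπ (R := R) n Y ≫ ((Ext R C n).map g.op).app Y =
      HomologicalComplex.cyclesMap (linearYonedaObjMap P P' φ.hom Y) n ≫ P'.extπ n Y := by
  have h₁ := congrArg Quiver.Hom.unop (isoLeftDerivedObj_hom_naturality g P' P φ.hom
    (by simpa using φ.hom_f_zero_comp_π_f_zero) ((linearYoneda R C).obj Y).rightOp n)
  have h₂ := congrArg Quiver.Hom.unop (HomologicalComplex.homologyOp_hom_naturality
    (linearYonedaObjMap (R := R) P P' φ.hom Y) n)
  have h₃ : (P.isoExt (R := R) n Y).inv ≫ ((Ext R C n).map g.op).app Y =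
      HomologicalComplex.homologyMap (linearYonedaObjMap P P' φ.hom Y) n ≫
        (P'.isoExt n Y).inv :=
    (congrArg (fun f => (HomologicalComplex.homologyUnop _ _).hom ≫ f) h₁).trans
      (congrArg (fun f => f ≫ (P'.isoLeftDerivedObj ((linearYoneda R C).obj Y).rightOp n).hom.unop)
        h₂)
  rw [extπ, extπ, Category.assoc, h₃, HomologicalComplex.homologyπ_naturality_assoc]

end

section

open Abelian

variable {C : Type*} [Category* C] [Abelian C] [HasExt C] {X Y : C} (P : ProjectiveResolution X)

lemma extMk_zero_eq_zero_iff (f : P.complex.X 0 ⟶ Y) (hf : P.complex.d 1 0 ≫ f = 0) :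
    P.extMk f 1 rfl hf = 0 ↔ f = 0 := by
  refine ⟨fun h => ?_, fun h => by subst h; simp⟩
  simp only [← P.extEquivCohomologyClass.apply_eq_iff_eq, extEquivCohomologyClass_extMk,
    extEquivCohomologyClass_zero, CochainComplex.HomComplex.CohomologyClass.mk_eq_zero_iff] at h
  rw [CochainComplex.HomComplex.Cocycle.toSingleMk_mem_coboundaries_iff _ _ _ _ _ 1 (by lia)] at h
  obtain ⟨g, hg⟩ := h
  have : g = 0 := (CochainComplex.isZero_of_isStrictlyLE P.cochainComplex 0 1).eq_of_src _ _
  rw [this, Limits.comp_zero] at hg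
  rwa [← cancel_epi (P.cochainComplexXIso (-(0 : ℕ)) 0 rfl).hom, Limits.comp_zero, eq_comm]

lemma extMk_eq_zero_iff_prev {n : ℕ} (f : P.complex.X n ⟶ Y)
    (hf : P.complex.d (n + 1) n ≫ f = 0) :
    P.extMk f (n + 1) rfl hf = 0 ↔
      ∃ g : P.complex.X ((ComplexShape.up ℕ).prev n) ⟶ Y, P.complex.d n _ ≫ g = f := by
  cases n with
  | zero =>
    rw [extMk_zero_eq_zero_iff, P.complex.shape 0 _ (by simp)]
    simp [eq_comm]
  | succ n =>
    rw [P.extMk_eq_zero_iff f _ rfl hf n rfl, CochainComplex.prev_nat_succ]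

end

section

open Abelian

variable {R : Type*} [CommRing R] {C : Type*} [Category* C] [Abelian C] [Linear R C]
  [HasExt C] {X X' : C} (P : ProjectiveResolution X)

lemma smul_extMk {n : ℕ} {Y : C} (r : R) (f : P.complex.X n ⟶ Y)
    (hf : P.complex.d (n + 1) n ≫ f = 0) :
    r • P.extMk f (n + 1) rfl hf = P.extMk (r • f) (n + 1) rfl (by simp [hf]) := by
  rw [Ext.smul_eq_comp_mk₀, extMk_comp_mk₀]
  simp

variable [EnoughProjectives C]

lemma ext_map_extπ_eq_zero_iff (g : X' ⟶ X) (n : ℕ) (Y : C)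
    (z : (P.complex.linearYonedaObj R Y).cycles n) :
    ((Ext R C n).map g.op).app Y (P.extπ n Y z) = 0 ↔
      (Ext.mk₀ g).comp (P.extMk (P.cocycleHom n Y z) (n + 1) rfl (P.d_comp_cocycleHom Y z))
        (zero_add n) = 0 := by
  let P' := projectiveResolution X'
  let φ : Hom P' P g := ⟨lift g P' P, by simpa using lift_commutes_zero g P' P⟩
  rw [mk₀_comp_extMk _ _ _ _ φ, extMk_eq_zero_iff_prev, ← ConcreteCategory.comp_apply,
    extπ_naturality P P' g φ, ConcreteCategory.comp_apply, extπ_eq_zero_iff, cocycleHom_cyclesMap]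

end

end CategoryTheory.ProjectiveResolution

namespace CategoryTheory

open Abelian

section

variable {R : Type*} [CommRing R] {C : Type*} [Category* C] [Abelian C] [Linear R C] [HasExt C]
  {D : Type*} [Category* D] (A : D ⥤ C)

/-- The scalar `x` kills the colimit of the groups `Ext (A.obj d) Y i` over `Dᵒᵖ`. -/
def EventuallyKills (i : ℕ) (Y : C) (x : R) : Prop :=
  ∀ (d : D) (e : Ext (A.obj d) Y i), ∃ (d' : D) (w : d' ⟶ d),
    x • (Ext.mk₀ (A.map w)).comp e (zero_add i) = 0

variable {A} {i : ℕ}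

lemma EventuallyKills.mul_left {Y : C} {x : R} (h : EventuallyKills A i Y x) (a : R) :
    EventuallyKills A i Y (a * x) := fun d e => by
  obtain ⟨d', w, hw⟩ := h d e
  exact ⟨d', w, by rw [mul_smul, hw, smul_zero]⟩

lemma EventuallyKills.of_smul_id_eq_zero {Y : C} {x : R} (h : x • 𝟙 Y = 0) :
    EventuallyKills A i Y x := fun d e =>
  ⟨d, 𝟙 d, by rw [Ext.smul_eq_comp_mk₀, h]; simp⟩

lemma EventuallyKills.middle {S : ShortComplex C} (hS : S.ShortExact) {x y : R}
    (h₁ : EventuallyKills A i S.X₁ x) (h₃ : EventuallyKills A i S.X₃ y) :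
    EventuallyKills A i S.X₂ (x * y) := fun d e => by
  obtain ⟨d', w, hw⟩ := h₃ d (e.comp (Ext.mk₀ S.g) (add_zero i))
  obtain ⟨e₁, he₁⟩ := Ext.covariant_sequence_exact₂ _ hS
    (y • (Ext.mk₀ (A.map w)).comp e (zero_add i))
    (by rw [Ext.smul_comp, Ext.comp_assoc_of_third_deg_zero, hw])
  obtain ⟨d'', w', hw'⟩ := h₁ d' e₁
  refine ⟨d'', w' ≫ w, ?_⟩
  rw [A.map_comp, ← Ext.mk₀_comp_mk₀_assoc, mul_smul,
    ← Ext.comp_smul, ← he₁, ← Ext.comp_assoc_of_third_deg_zero, ← Ext.smul_comp, hw',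
    Ext.zero_comp]

lemma EventuallyKills.left {S : ShortComplex C} (hS : S.ShortExact) {x y : R}
    (h₂ : EventuallyKills A (i + 1) S.X₂ x) (h₃ : EventuallyKills A i S.X₃ y) :
    EventuallyKills A (i + 1) S.X₁ (x * y) := fun d e => by
  obtain ⟨d', w, hw⟩ := h₂ d (e.comp (Ext.mk₀ S.f) (add_zero _))
  obtain ⟨e₃, he₃⟩ := Ext.covariant_sequence_exact₁ _ hS
    (x • (Ext.mk₀ (A.map w)).comp e (zero_add _))
    (by rw [Ext.smul_comp, Ext.comp_assoc_of_third_deg_zero, hw]) rfl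
  obtain ⟨d'', w', hw'⟩ := h₃ d' e₃
  refine ⟨d'', w' ≫ w, ?_⟩
  rw [A.map_comp, ← Ext.mk₀_comp_mk₀_assoc, mul_comm, mul_smul,
    ← Ext.comp_smul, ← he₃, ← Ext.comp_assoc _ _ _ (zero_add _) _ (by lia), ← Ext.smul_comp, hw',
    Ext.zero_comp]

lemma EventuallyKills.of_mono {X Y : C} (f : X ⟶ Y) [Mono f] {x : R}
    (h : EventuallyKills A 0 Y x) : EventuallyKills A 0 X x := fun d e => by
  obtain ⟨d', w, hw⟩ := h d (e.comp (Ext.mk₀ f) (add_zero _))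
  refine ⟨d', w, Ext.postcomp_mk₀_injective_of_mono _ f ?_⟩
  change (x • (Ext.mk₀ (A.map w)).comp e (zero_add 0)).comp (Ext.mk₀ f) (add_zero 0) =
    (0 : Ext _ _ 0).comp (Ext.mk₀ f) (add_zero 0)
  rw [Ext.smul_comp, Ext.comp_assoc_of_third_deg_zero, hw, Ext.zero_comp]

end

end CategoryTheory

section

open CategoryTheory Abelian Limits Opposite ProjectiveResolution

variable {R : Type} [CommRing R]

namespace localCohomology

lemma smul_ext_map_extπ_eq_zero_iff {X X' Y : ModuleCat.{0} R} (P : ProjectiveResolution X)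
    (w : X' ⟶ X) (i : ℕ) (x : R) (z : (P.complex.linearYonedaObj R Y).cycles i) :
    x • (((_root_.Ext R (ModuleCat.{0} R) i).map w.op).app Y (P.extπ i Y z)) = 0 ↔
      x • (Ext.mk₀ w).comp (P.extMk (P.cocycleHom i Y z) (i + 1) rfl (P.d_comp_cocycleHom Y z))
        (zero_add i) = 0 := by
  rw [← map_smul, ← map_smul, ext_map_extπ_eq_zero_iff, ← Ext.comp_smul, smul_extMk]
  simp only [map_smul]

/-- An element kills local cohomology if and only if it kills the corresponding filtered system
of `Ext` groups. -/
theorem smul_eq_zero_iff_eventuallyKills (I : Ideal R) (i : ℕ) (Y : ModuleCat.{0} R) (x : R) :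
    (∀ y : (localCohomology I i).obj Y, x • y = 0) ↔
      EventuallyKills (ringModIdeals (idealPowersDiagram I)) i Y x := by
  let A := ringModIdeals (idealPowersDiagram I)
  let F : ℕᵒᵖᵒᵖ ⥤ ModuleCat.{0} R :=
    diagram (idealPowersDiagram I) i ⋙ (evaluation _ _).obj Y
  let α : (localCohomology I i).obj Y ≅ colimit F :=
    colimitObjIsoColimitCompEvaluation (diagram (idealPowersDiagram I) i) Y
  have hα : (∀ y : (localCohomology I i).obj Y, x • y = 0) ↔
      ∀ y : (colimit F : ModuleCat.{0} R), x • y = 0 :=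
    α.toLinearEquiv.toEquiv.forall_congr fun y => by
      change _ ↔ x • α.toLinearEquiv y = 0
      rw [← map_smul, LinearEquiv.map_eq_zero_iff]
  have hF : (∀ y : (colimit F : ModuleCat.{0} R), x • y = 0) ↔
      ∀ (d : ℕᵒᵖᵒᵖ) (u : F.obj d), ∃ (d' : ℕᵒᵖᵒᵖ) (w : d ⟶ d'), x • F.map w u = 0 := by
    refine ⟨fun h d u => ?_, fun h y => ?_⟩
    · obtain ⟨d', w, hw⟩ := Concrete.colimit_rep_eq_zero R F d (x • u) (by rw [map_smul, h])
      exact ⟨d', w, by rw [← map_smul]; exact hw⟩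
    · obtain ⟨d, u, rfl⟩ := Concrete.colimit_exists_rep F y
      obtain ⟨d', w, hw⟩ := h d u
      rw [← colimit.w F w, ConcreteCategory.comp_apply, ← map_smul, hw, map_zero]
  rw [hα, hF]
  refine ⟨fun h d e => ?_, fun h d u => ?_⟩
  · let P := projectiveResolution (A.obj d)
    obtain ⟨f, hf, rfl⟩ := P.extMk_surjective e (i + 1) rfl
    obtain ⟨z, rfl⟩ := P.exists_cocycleHom_eq (R := R) Y f hf
    obtain ⟨d', w, hw⟩ := h (op d) (P.extπ i Y z)
    exact ⟨d'.unop, w.unop, (smul_ext_map_extπ_eq_zero_iff P _ i x z).1 hw⟩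
  · let P := projectiveResolution (A.obj d.unop)
    obtain ⟨z, rfl⟩ := P.extπ_surjective (R := R) i Y u
    obtain ⟨d', w, hw⟩ := h d.unop
      (P.extMk (P.cocycleHom i Y z) (i + 1) rfl (P.d_comp_cocycleHom Y z))
    exact ⟨op d', w.op, (smul_ext_map_extπ_eq_zero_iff P _ i x z).2 hw⟩

end localCohomology

end

section

open localCohomology

variable {R : Type} [CommRing R]

lemma Ideal.exists_mem_forall_notMem_minimalPrimes [IsNoetherianRing R] {I p : Ideal R}
    [p.IsPrime] (hI : I ≤ p) (hp : p ∉ I.minimalPrimes) :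
    ∃ y ∈ p, ∀ q ∈ I.minimalPrimes, y ∉ q := by
  by_contra! h
  obtain ⟨q, hq, hpq⟩ := (Ideal.subset_union_prime_finite
    (I.finite_minimalPrimes_of_isNoetherianRing R) (f := id) ⊥ ⊥ fun q hq _ _ => hq.isPrime).1
    fun y hy => Set.mem_iUnion₂.2 <| by simpa using h y hy
  exact hp (le_antisymm hpq (hq.2 ⟨‹_›, hI⟩ hpq) ▸ hq)

namespace Paper

lemma annihilator_le_radical_of_supp_eq {M N : Type} [AddCommGroup M] [Module R M]
    [AddCommGroup N] [Module R N] (h : supp R M = supp R N) :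
    Module.annihilator R M ≤ (Module.annihilator R N).radical := by
  rw [Ideal.radical_eq_sInf]
  exact le_sInf fun p hp => (h.symm.subset ⟨hp.2, hp.1⟩).2

lemma minSupp_congr {M N : Type} [AddCommGroup M] [Module R M]
    [AddCommGroup N] [Module R N] (h : supp R M = supp R N) : minSupp R M = minSupp R N :=
  congrArg (fun s : Set (Ideal R) => {p | Minimal (· ∈ s) p}) h

lemma dimModAt_congr {M N : Type} [AddCommGroup M] [Module R M]
    [AddCommGroup N] [Module R N] (h : supp R M = supp R N) (q : Ideal R) :
    dimModAt R M q = dimModAt R N q := by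
  have hp (p : Ideal R) : (p.IsPrime ∧ Module.annihilator R M ≤ p ∧ p ≤ q) ↔
      (p.IsPrime ∧ Module.annihilator R N ≤ p ∧ p ≤ q) := by
    rw [← and_assoc, ← and_assoc]
    exact and_congr_left' (Set.ext_iff.1 h p)
  exact congrArg (fun s : Set (Ideal R) => Order.krullDim s) (Set.ext hp)

lemma dimModAt_le_dimMod (M : Type) [AddCommGroup M] [Module R M] (q : Ideal R) :
    dimModAt R M q ≤ dimMod R M :=
  Order.krullDim_le_of_strictMono
    (fun p : {p : Ideal R // p.IsPrime ∧ Module.annihilator R M ≤ p ∧ p ≤ q} =>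
      (⟨p.1, p.2.1, p.2.2.1⟩ : {p : Ideal R // p.IsPrime ∧ Module.annihilator R M ≤ p}))
    fun _ _ hab => hab

/-- If some scalar outside the minimal primes of `M` kills the cohomology of `M` in every degree
`i` along the ideals of `Q i`, then in each degree there is such a scalar for every finitely
generated module supported on the support of `M`. -/
theorem exists_eventuallyKills [IsNoetherianRing R] {M : Type} [AddCommGroup M] [Module R M]
    [Module.Finite R M] {x : R} (hx : ∀ p ∈ minSupp R M, x ∉ p) {Q : ℕ → Set (Ideal R)}
    (hQ : ∀ i, Q (i + 1) ⊆ Q i)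
    (hM : ∀ i, ∀ I ∈ Q i,
      EventuallyKills (ringModIdeals (idealPowersDiagram I)) i (ModuleCat.of R M) x)
    (i : ℕ) (N : Type) [AddCommGroup N] [Module R N] [Module.Finite R N]
    (hN : Module.annihilator R M ≤ (Module.annihilator R N).radical) :
    ∃ y, (∀ p ∈ minSupp R M, y ∉ p) ∧ ∀ I ∈ Q i,
      EventuallyKills (ringModIdeals (idealPowersDiagram I)) i (ModuleCat.of R N) y := by
  have hmul {a b : R} (ha : ∀ p ∈ minSupp R M, a ∉ p) (hb : ∀ p ∈ minSupp R M, b ∉ p) :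
      ∀ p ∈ minSupp R M, a * b ∉ p := fun p hp =>
    hp.1.1.mul_notMem (ha p hp) (hb p hp)
  induction i using Nat.strong_induction_on generalizing N with | _ i ih
  induction ‹Module.Finite R N› using IsNoetherianRing.induction_on_isQuotientEquivQuotientPrime R
    with
  | subsingleton N =>
    refine ⟨1, fun p hp => hp.1.1.one_notMem, fun I _ => .of_smul_id_eq_zero ?_⟩
    ext y
    exact Subsingleton.elim (α := N) _ _
  | quotient N p f =>
    have hann : Module.annihilator R N = p.1 := by
      rw [f.annihilator_eq, Ideal.annihilator_quotient]
    rw [hann, p.2.isRadical.radical] at hN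
    by_cases hp : p.1 ∈ minSupp R M
    · obtain ⟨-, g, hg⟩ := (isAssociatedPrime_iff_exists_injective_linearMap _ _).1
        (Module.associatedPrimes.minimalPrimes_annihilator_subset_associatedPrimes R M hp)
      have hinj : Function.Injective (g ∘ₗ f.toLinearMap) := hg.comp f.injective
      have hS : (ModuleCat.shortComplexOfCompEqZero (g ∘ₗ f.toLinearMap)
          (LinearMap.range (g ∘ₗ f.toLinearMap)).mkQ (LinearMap.range_mkQ_comp _)).ShortExact :=
        ModuleCat.shortComplex_shortExact _ (LinearMap.exact_map_mkQ_range _) hinj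
          (Submodule.mkQ_surjective _)
      cases i with
      | zero =>
        have := hS.mono_f
        exact ⟨x, hx, fun I hI => (hM 0 I hI).of_mono (ModuleCat.ofHom (g ∘ₗ f.toLinearMap))⟩
      | succ i =>
        obtain ⟨y, hy, hyQ⟩ := ih i i.lt_succ_self (M ⧸ LinearMap.range (g ∘ₗ f.toLinearMap))
          (((Submodule.mkQ _).annihilator_le_of_surjective (Submodule.mkQ_surjective _)).trans
            Ideal.le_radical)
        exact ⟨x * y, hmul hx hy, fun I hI => (hM _ I hI).left hS (hyQ I (hQ i hI))⟩
    · have := p.2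
      obtain ⟨y, hyp, hy⟩ := Ideal.exists_mem_forall_notMem_minimalPrimes hN hp
      rw [← hann, Module.mem_annihilator] at hyp
      refine ⟨y, hy, fun I _ => .of_smul_id_eq_zero ?_⟩
      ext z
      exact hyp z
  | exact N₁ N₂ N₃ f g hf hg hfg h₁ h₃ =>
    obtain ⟨y₁, hy₁, hQ₁⟩ := h₁ <| hN.trans <| Ideal.radical_mono <|
      f.annihilator_le_of_injective hf
    obtain ⟨y₃, hy₃, hQ₃⟩ := h₃ <| hN.trans <| Ideal.radical_mono <|
      g.annihilator_le_of_surjective hg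
    have hS : (ModuleCat.shortComplexOfCompEqZero f g hfg.linearMap_comp_eq_zero).ShortExact :=
      ModuleCat.shortComplex_shortExact _ hfg hf hg
    exact ⟨y₁ * y₃, hmul hy₁ hy₃, fun I hI => (hQ₁ I hI).middle hS (hQ₃ I hI)⟩

theorem HasULCA.of_supp_eq [IsNoetherianRing R] {M N : Type} [AddCommGroup M] [Module R M]
    [Module.Finite R M] [AddCommGroup N] [Module R N] [Module.Finite R N]
    (hd : dimMod R M < ⊤) (hsupp : supp R M = supp R N) (h : HasULCA R M) : HasULCA R N := by
  obtain ⟨x, hx, hxM⟩ := h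
  obtain ⟨d, hd⟩ : ∃ d : ℕ, dimMod R M ≤ d := by
    generalize dimMod R M = D at hd
    induction D with
    | bot => exact ⟨0, bot_le⟩
    | coe D =>
      obtain ⟨d, rfl⟩ := ENat.ne_top_iff_exists.1 (WithBot.coe_lt_coe.1 hd).ne
      exact ⟨d, le_rfl⟩
  choose y hy hyN using fun i => exists_eventuallyKills hx
    (Q := fun i => {m | m.IsMaximal ∧ (i : WithBot ℕ∞) < dimModAt R M m})
    (fun i m hm => ⟨hm.1, lt_trans (by exact_mod_cast i.lt_succ_self) hm.2⟩)
    (fun i m hm => (smul_eq_zero_iff_eventuallyKills m i _ x).1 (hxM m hm.1 i hm.2))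
    i N (annihilator_le_radical_of_supp_eq hsupp)
  refine ⟨∏ i ∈ Finset.range d, y i, fun p hp => ?_, fun m hm i hi => ?_⟩
  · rw [← minSupp_congr hsupp] at hp
    have := hp.1.1
    rw [this.prod_mem_iff]
    rintro ⟨i, -, hi⟩
    exact hy i p hp hi
  · rw [← dimModAt_congr hsupp] at hi
    have hid : i ∈ Finset.range d := Finset.mem_range.2 <| by
      exact_mod_cast hi.trans_le ((dimModAt_le_dimMod M m).trans hd)
    rw [← Finset.prod_erase_mul _ _ hid]
    exact (smul_eq_zero_iff_eventuallyKills m i _ _).2 ((hyN i m ⟨hm, hi⟩).mul_left _)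

end Paper

end

/-- For finitely generated modules of finite dimension with the same support over a
Noetherian ring, having a uniform local cohomological annihilator depends only on the
support. -/
theorem hasULCA_iff_of_supp_eq (R : Type) [CommRing R] [IsNoetherianRing R]
    (M N : Type) [AddCommGroup M] [Module R M] [Module.Finite R M]
    [AddCommGroup N] [Module R N] [Module.Finite R N]
    (hdM : Paper.dimMod R M < ⊤) (hdN : Paper.dimMod R N < ⊤)
    (hsupp : Paper.supp R M = Paper.supp R N) :
    Paper.HasULCA R M ↔ Paper.HasULCA R N := by
  exact ⟨.of_supp_eq hdM hsupp, .of_supp_eq hdN hsupp.symm⟩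
end
end
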